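/- arXiv:1603.04193 — 3 statements merged into one kernel-verified Lean document; each statement's English description precedes it below -/
import Mathlib

section
/- Let X ⊆ ℝⁿ be a real algebraic set and let f be a nonzero regulous function on X. Then Z(f) = {x ∈ X : f(x) = 0} is Zariski closed (i.e. is a real algebraic subset of X) if and only if there exists a polynomial function p on X such that sign(f)(x) = sign(p)(x) for all x ∈ X. -/
open MvPolynomial Set

/-- A real algebraic set: the common zero locus of finitely many real polynomials. -/
def IsRealAlgebraicSet {n : ℕ} (X : Set (Fin n → ℝ)) : Prop :=
  ∃ (k : ℕ) (p : Fin k → MvPolynomial (Fin n) ℝ),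
    X = {x | ∀ i, MvPolynomial.eval x (p i) = 0}

/-- `V` is a real algebraic subset of `X`, i.e. a Zariski closed subset of `X`. -/
def IsZariskiClosedIn {n : ℕ} (X V : Set (Fin n → ℝ)) : Prop :=
  IsRealAlgebraicSet V ∧ V ⊆ X

/-- `U` is a Zariski open subset of `X`. -/
def IsZariskiOpenIn {n : ℕ} (X U : Set (Fin n → ℝ)) : Prop :=
  U ⊆ X ∧ IsRealAlgebraicSet (X \ U)

/-- `U` is Zariski dense in `X`. -/
def IsZariskiDenseIn {n : ℕ} (X U : Set (Fin n → ℝ)) : Prop :=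
  ∀ V, IsZariskiClosedIn X V → U ⊆ V → V = X

/-- `f` is regular on `U` : on `U`, `f = p / q` with `q` nonvanishing on `U`. -/
def IsRegularOnSet {n : ℕ} (U : Set (Fin n → ℝ)) (f : (Fin n → ℝ) → ℝ) : Prop :=
  ∃ p q : MvPolynomial (Fin n) ℝ,
    (∀ x ∈ U, MvPolynomial.eval x q ≠ 0) ∧
    ∀ x ∈ U, f x = MvPolynomial.eval x p / MvPolynomial.eval x q

/-- A rational continuous function on `X`: continuous on `X` (euclidean topology) and
regular on a Zariski-dense Zariski-open subset of `X`. -/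
def IsRatCont {n : ℕ} (X : Set (Fin n → ℝ)) (f : (Fin n → ℝ) → ℝ) : Prop :=
  ContinuousOn f X ∧
    ∃ U, IsZariskiOpenIn X U ∧ IsZariskiDenseIn X U ∧ IsRegularOnSet U f

/-- A regulous function on `ℝⁿ`: continuous, and equal to a quotient of polynomials on a
nonempty Zariski open subset of `ℝⁿ`. -/
def IsRegulous {n : ℕ} (f : (Fin n → ℝ) → ℝ) : Prop :=
  Continuous f ∧
    ∃ U : Set (Fin n → ℝ), IsZariskiOpenIn Set.univ U ∧ U.Nonempty ∧ IsRegularOnSet U f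

/-- A regulous function on `X`: the restriction to `X` of a regulous function on `ℝⁿ`. -/
def IsRegulousOn {n : ℕ} (X : Set (Fin n → ℝ)) (f : (Fin n → ℝ) → ℝ) : Prop :=
  ∃ g : (Fin n → ℝ) → ℝ, IsRegulous g ∧ ∀ x ∈ X, f x = g x

/-- The largest Zariski open subset of `X` on which `f` is regular. -/
def regularDomain {n : ℕ} (X : Set (Fin n → ℝ)) (f : (Fin n → ℝ) → ℝ) : Set (Fin n → ℝ) :=
  ⋃₀ {U | IsZariskiOpenIn X U ∧ IsRegularOnSet U f}

/-- The polar locus of `f` on `X`. -/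
def polarLocus {n : ℕ} (X : Set (Fin n → ℝ)) (f : (Fin n → ℝ) → ℝ) : Set (Fin n → ℝ) :=
  X \ regularDomain X f

/-- The ideal of polynomials vanishing on `X`. -/
noncomputable def vanishingIdealOf {n : ℕ} (X : Set (Fin n → ℝ)) : Ideal (MvPolynomial (Fin n) ℝ) where
  carrier := {p | ∀ x ∈ X, MvPolynomial.eval x p = 0}
  add_mem' := by
    intro a b ha hb x hx
    simp [map_add, ha x hx, hb x hx]
  zero_mem' := by intro x hx; simp
  smul_mem' := by
    intro c p hp x hx
    simp [smul_eq_mul, map_mul, hp x hx]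

/-- The dimension of `X`: the Krull dimension of its coordinate ring. -/
noncomputable def algDim {n : ℕ} (X : Set (Fin n → ℝ)) : WithBot ℕ∞ :=
  ringKrullDim (MvPolynomial (Fin n) ℝ ⧸ vanishingIdealOf X)

/-- `x` is a regular (nonsingular) point of `X`: locally around `x`, `X` is the common zero
set of `n - d` polynomials (`d = dim X`) whose gradients at `x` are linearly independent. -/
def IsRegularPoint {n : ℕ} (X : Set (Fin n → ℝ)) (x : Fin n → ℝ) : Prop :=
  x ∈ X ∧ ∃ d : ℕ, algDim X = (d : WithBot ℕ∞) ∧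
    ∃ (p : Fin (n - d) → MvPolynomial (Fin n) ℝ) (U : Set (Fin n → ℝ)),
      IsOpen U ∧ x ∈ U ∧
      X ∩ U = {y ∈ U | ∀ j, MvPolynomial.eval y (p j) = 0} ∧
      LinearIndependent ℝ fun j : Fin (n - d) =>
        fun i : Fin n => MvPolynomial.eval x (MvPolynomial.pderiv i (p j))

/-- `X` is central: it is the euclidean closure of its set of regular points. -/
def IsCentral {n : ℕ} (X : Set (Fin n → ℝ)) : Prop :=
  closure {x | IsRegularPoint X x} = X

/-- A semi-algebraic subset of `ℝᵐ`: a finite union of sets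
`{x | p x = 0, q₁ x > 0, …, q_k x > 0}`. -/
def IsSemialgebraic {m : ℕ} (S : Set (Fin m → ℝ)) : Prop :=
  ∃ (N : ℕ) (P : Fin N → MvPolynomial (Fin m) ℝ) (k : Fin N → ℕ)
    (Q : (i : Fin N) → Fin (k i) → MvPolynomial (Fin m) ℝ),
    S = ⋃ i, {x | MvPolynomial.eval x (P i) = 0 ∧ ∀ j, 0 < MvPolynomial.eval x (Q i j)}

/-- The graph of `f : X → ℝ`, as a subset of `ℝⁿ⁺¹`. -/
def graphOn {n : ℕ} (X : Set (Fin n → ℝ)) (f : (Fin n → ℝ) → ℝ) : Set (Fin (n + 1) → ℝ) :=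
  {y | (fun i : Fin n => y i.castSucc) ∈ X ∧ y (Fin.last n) = f fun i : Fin n => y i.castSucc}

/-- `f` is a semi-algebraic function on `X`: its graph is semi-algebraic in `ℝⁿ⁺¹`. -/
def IsSemialgebraicFnOn {n : ℕ} (X : Set (Fin n → ℝ)) (f : (Fin n → ℝ) → ℝ) : Prop :=
  IsSemialgebraic (graphOn X f)

/-- The interior of `S` in `X` for the euclidean topology of `X`. -/
def interiorIn {n : ℕ} (X S : Set (Fin n → ℝ)) : Set (Fin n → ℝ) :=
  {x ∈ X | ∃ U, IsOpen U ∧ x ∈ U ∧ U ∩ X ⊆ S}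

/-- The euclidean boundary of `S` in `X`: closure of `S` in `X` minus interior of `S` in `X`. -/
def bdIn {n : ℕ} (X S : Set (Fin n → ℝ)) : Set (Fin n → ℝ) :=
  (closure S ∩ X) \ interiorIn X S

/-- The Zariski closure of `E` in `X`: the smallest real algebraic subset of `X`
containing `E`. -/
def zarClosureIn {n : ℕ} (X E : Set (Fin n → ℝ)) : Set (Fin n → ℝ) :=
  ⋂₀ {V | IsZariskiClosedIn X V ∧ E ⊆ V}

/-- `V` is a regulous closed subset of `X`: the zero set of a regulous function on `X`. -/
def IsRegulousClosedIn {n : ℕ} (X V : Set (Fin n → ℝ)) : Prop :=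
  ∃ f : (Fin n → ℝ) → ℝ, IsRegulousOn X f ∧ V = {x ∈ X | f x = 0}

/-- The regulous closure of `E` in `X`: the smallest regulous closed subset of `X`
containing `E`. -/
def regClosureIn {n : ℕ} (X E : Set (Fin n → ℝ)) : Set (Fin n → ℝ) :=
  ⋂₀ {V | IsRegulousClosedIn X V ∧ E ⊆ V}

/-- `X` is an irreducible real algebraic set: it is not the union of two proper real
algebraic subsets. -/
def IsIrreducibleAlgSet {n : ℕ} (X : Set (Fin n → ℝ)) : Prop :=
  IsRealAlgebraicSet X ∧
    ∀ V W : Set (Fin n → ℝ), IsZariskiClosedIn X V → IsZariskiClosedIn X W →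
      X = V ∪ W → V = X ∨ W = X


def SP (Γ : Finset (ℝ × ℝ)) (y y' : ℝ) : Prop :=
  ∀ g ∈ Γ, (y < g.1 ↔ y' < g.2) ∧ (g.1 < y ↔ g.2 < y')

lemma SP_swap {Γ : Finset (ℝ × ℝ)} {y y' : ℝ} :
    SP (Γ.image Prod.swap) y' y ↔ SP Γ y y' := by
  constructor
  · intro h g hg
    have := h g.swap (Finset.mem_image_of_mem _ hg)
    exact ⟨this.1.symm, this.2.symm⟩
  · intro h g hg
    obtain ⟨g, hg1, rfl⟩ := Finset.mem_image.1 hg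
    have := h g hg1
    exact ⟨this.1.symm, this.2.symm⟩

lemma SP_eq {Γ : Finset (ℝ × ℝ)} {y y' : ℝ} (h : SP Γ y y') {g : ℝ × ℝ} (hg : g ∈ Γ) :
    g.1 = y ↔ g.2 = y' := by
  have := h g hg
  constructor
  · intro e
    rcases lt_trichotomy g.2 y' with h1 | h1 | h1
    · have := this.2.2 h1; linarith
    · exact h1
    · have := this.1.2 h1; linarith
  · intro e
    rcases lt_trichotomy g.1 y with h1 | h1 | h1
    · have := this.2.1 h1; linarith
    · exact h1
    · have := this.1.1 h1; linarith

lemma SP_exists {Γ : Finset (ℝ × ℝ)} (hΓ : ∀ g ∈ Γ, SP Γ g.1 g.2) (y : ℝ) :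
    ∃ y', SP Γ y y' := by
  classical
  by_cases hy : ∃ g ∈ Γ, g.1 = y
  · obtain ⟨g, hg, rfl⟩ := hy
    exact ⟨g.2, hΓ g hg⟩
  · push Not at hy
    obtain ⟨m, h1, h2⟩ := Order.exists_between_finsets
      (lo := (Γ.filter (fun g => g.1 < y)).image Prod.snd)
      (hi := (Γ.filter (fun g => y < g.1)).image Prod.snd) (by
        intro a ha b hb
        simp only [Finset.mem_image, Finset.mem_filter] at ha hb
        obtain ⟨g, ⟨hg, h1⟩, rfl⟩ := ha
        obtain ⟨k, ⟨hk, h2⟩, rfl⟩ := hb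
        exact ((hΓ g hg) k hk).1.1 (h1.trans h2))
    refine ⟨m, fun g hg => ?_⟩
    rcases lt_or_gt_of_ne (hy g hg) with h | h
    · have := h1 g.2 (Finset.mem_image_of_mem _ (Finset.mem_filter.2 ⟨hg, h⟩))
      exact ⟨⟨fun h' => by linarith, fun h' => by linarith⟩, ⟨fun _ => this, fun _ => h⟩⟩
    · have := h2 g.2 (Finset.mem_image_of_mem _ (Finset.mem_filter.2 ⟨hg, h⟩))
      exact ⟨⟨fun _ => this, fun _ => h⟩, ⟨fun h' => by linarith, fun h' => by linarith⟩⟩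

structure St (Γ : Finset (ℝ × ℝ)) (P P' d d' : ℝ → ℝ) : Prop where
  hP : ∀ t, HasDerivAt P (d t) t
  hP' : ∀ t, HasDerivAt P' (d' t) t
  cons : ∀ g ∈ Γ, SP Γ g.1 g.2
  hd : ∀ y y', SP Γ y y' → SignType.sign (d y) = SignType.sign (d' y')
  hr : ∀ y, d y = 0 → ∃ g ∈ Γ, g.1 = y
  hr' : ∀ y, d' y = 0 → ∃ g ∈ Γ, g.2 = y
  hs : ∀ g ∈ Γ, SignType.sign (P g.1) = SignType.sign (P' g.2)
  ht : ∃ N, ∀ t ≥ N, ∀ t' ≥ N, SignType.sign (P t) = SignType.sign (P' t')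
  hb : ∃ N, ∀ t ≤ N, ∀ t' ≤ N, SignType.sign (P t) = SignType.sign (P' t')

lemma St.swap {Γ : Finset (ℝ × ℝ)} {P P' d d' : ℝ → ℝ} (h : St Γ P P' d d') :
    St (Γ.image Prod.swap) P' P d' d where
  hP := h.hP'
  hP' := h.hP
  cons := by
    intro g hg
    obtain ⟨g, hg1, rfl⟩ := Finset.mem_image.1 hg
    exact SP_swap.2 (h.cons g hg1)
  hd := fun y y' hy => (h.hd y' y (SP_swap.1 hy)).symm
  hr := fun y hy => by
    obtain ⟨g, hg, e⟩ := h.hr' y hy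
    exact ⟨g.swap, Finset.mem_image_of_mem _ hg, e⟩
  hr' := fun y hy => by
    obtain ⟨g, hg, e⟩ := h.hr y hy
    exact ⟨g.swap, Finset.mem_image_of_mem _ hg, e⟩
  hs := by
    intro g hg
    obtain ⟨g, hg1, rfl⟩ := Finset.mem_image.1 hg
    exact (h.hs g hg1).symm
  ht := by
    obtain ⟨N, hN⟩ := h.ht
    exact ⟨N, fun t h1 t' h2 => (hN t' h2 t h1).symm⟩
  hb := by
    obtain ⟨N, hN⟩ := h.hb
    exact ⟨N, fun t h1 t' h2 => (hN t' h2 t h1).symm⟩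

lemma St.neg {Γ : Finset (ℝ × ℝ)} {P P' d d' : ℝ → ℝ} (h : St Γ P P' d d') :
    St Γ (fun t => - P t) (fun t => - P' t) (fun t => - d t) (fun t => - d' t) where
  hP := fun t => (h.hP t).neg
  hP' := fun t => (h.hP' t).neg
  cons := h.cons
  hd := fun y y' hy => by
    have := h.hd y y' hy
    simp only [Left.sign_neg, this]
  hr := fun y hy => h.hr y (by simpa using hy)
  hr' := fun y hy => h.hr' y (by simpa using hy)
  hs := by
    intro g hg
    have := h.hs g hg
    simp only [Left.sign_neg, this]
  ht := by
    obtain ⟨N, hN⟩ := h.ht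
    exact ⟨N, fun t h1 t' h2 => by have := hN t h1 t' h2; simp only [Left.sign_neg, this]⟩
  hb := by
    obtain ⟨N, hN⟩ := h.hb
    exact ⟨N, fun t h1 t' h2 => by have := hN t h1 t' h2; simp only [Left.sign_neg, this]⟩

lemma St.right {Γ : Finset (ℝ × ℝ)} {P P' d d' : ℝ → ℝ} (h : St Γ P P' d d') {y y' : ℝ}
    (hy : SP Γ y y') (hn : ∀ g ∈ Γ, g.1 ≠ y) :
    ∃ u > y, ∃ u' > y', SignType.sign (P u) = SignType.sign (P' u') ∧
      (∀ t, y ≤ t → t < u → SP Γ t y') ∧ (∀ t, y' ≤ t → t < u' → SP Γ y t) := by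
  classical
  have hn' : ∀ g ∈ Γ, g.2 ≠ y' := fun g hg e => hn g hg ((SP_eq hy hg).2 e)
  by_cases hne : (Γ.filter (fun g => y < g.1)).Nonempty
  · obtain ⟨m, hm, hmin⟩ := Finset.exists_min_image _ Prod.fst hne
    rw [Finset.mem_filter] at hm
    have key : ∀ g ∈ Γ, y < g.1 → m.1 ≤ g.1 := fun g hg h1 =>
      hmin g (Finset.mem_filter.2 ⟨hg, h1⟩)
    have key' : ∀ g ∈ Γ, y' < g.2 → m.2 ≤ g.2 := fun g hg h1 => by
      have h2 := key g hg ((hy g hg).1.2 h1)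
      by_contra h3
      have := (h.cons m hm.1 g hg).2.2 (not_le.1 h3)
      linarith
    refine ⟨m.1, hm.2, m.2, (hy m hm.1).1.1 hm.2, h.hs m hm.1, ?_, ?_⟩
    · intro t h1 h2 g hg
      have a := hy g hg
      rcases lt_or_gt_of_ne (hn g hg) with h3 | h3
      · have := a.2.1 h3
        exact ⟨⟨fun _ => by linarith, fun _ => by linarith⟩, ⟨fun _ => this, fun _ => by linarith⟩⟩
      · have := a.1.1 h3
        have := key g hg h3
        exact ⟨⟨fun _ => by linarith, fun _ => by linarith⟩, ⟨fun _ => by linarith, fun _ => by linarith⟩⟩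
    · intro t h1 h2 g hg
      have a := hy g hg
      rcases lt_or_gt_of_ne (hn' g hg) with h3 | h3
      · have := a.2.2 h3
        exact ⟨⟨fun _ => by linarith, fun _ => by linarith⟩, ⟨fun _ => by linarith, fun _ => by linarith⟩⟩
      · have := a.1.2 h3
        have := key' g hg h3
        exact ⟨⟨fun _ => by linarith, fun _ => by linarith⟩, ⟨fun _ => by linarith, fun _ => by linarith⟩⟩
  · have key : ∀ g ∈ Γ, g.1 < y := fun g hg => by
      rcases lt_or_gt_of_ne (hn g hg) with h3 | h3
      · exact h3
      · exact absurd ⟨g, Finset.mem_filter.2 ⟨hg, h3⟩⟩ hne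
    have key' : ∀ g ∈ Γ, g.2 < y' := fun g hg => (hy g hg).2.1 (key g hg)
    obtain ⟨N, hN⟩ := h.ht
    refine ⟨max N y + 1, by linarith [le_max_right N y], max N y' + 1,
      by linarith [le_max_right N y'], hN _ (by linarith [le_max_left N y]) _
      (by linarith [le_max_left N y']), ?_, ?_⟩
    · intro t h1 h2 g hg
      have := key g hg
      have := key' g hg
      exact ⟨⟨fun _ => by linarith, fun _ => by linarith⟩, ⟨fun _ => by linarith, fun _ => by linarith⟩⟩
    · intro t h1 h2 g hg
      have := key g hg
      have := key' g hg
      exact ⟨⟨fun _ => by linarith, fun _ => by linarith⟩, ⟨fun _ => by linarith, fun _ => by linarith⟩⟩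

lemma St.left {Γ : Finset (ℝ × ℝ)} {P P' d d' : ℝ → ℝ} (h : St Γ P P' d d') {y y' : ℝ}
    (hy : SP Γ y y') (hn : ∀ g ∈ Γ, g.1 ≠ y) :
    ∃ u < y, ∃ u' < y', SignType.sign (P u) = SignType.sign (P' u') ∧
      (∀ t, t ≤ y → u < t → SP Γ t y') ∧ (∀ t, t ≤ y' → u' < t → SP Γ y t) := by
  classical
  have hn' : ∀ g ∈ Γ, g.2 ≠ y' := fun g hg e => hn g hg ((SP_eq hy hg).2 e)
  by_cases hne : (Γ.filter (fun g => g.1 < y)).Nonempty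
  · obtain ⟨m, hm, hmin⟩ := Finset.exists_max_image _ Prod.fst hne
    rw [Finset.mem_filter] at hm
    have key : ∀ g ∈ Γ, g.1 < y → g.1 ≤ m.1 := fun g hg h1 =>
      hmin g (Finset.mem_filter.2 ⟨hg, h1⟩)
    have key' : ∀ g ∈ Γ, g.2 < y' → g.2 ≤ m.2 := fun g hg h1 => by
      have h2 := key g hg ((hy g hg).2.2 h1)
      by_contra h3
      have := (h.cons m hm.1 g hg).1.2 (not_le.1 h3)
      linarith
    refine ⟨m.1, hm.2, m.2, (hy m hm.1).2.1 hm.2, h.hs m hm.1, ?_, ?_⟩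
    · intro t h1 h2 g hg
      have a := hy g hg
      rcases lt_or_gt_of_ne (hn g hg) with h3 | h3
      · have := a.2.1 h3
        have := key g hg h3
        exact ⟨⟨fun _ => by linarith, fun _ => by linarith⟩, ⟨fun _ => by linarith, fun _ => by linarith⟩⟩
      · have := a.1.1 h3
        exact ⟨⟨fun _ => by linarith, fun _ => by linarith⟩, ⟨fun _ => by linarith, fun _ => by linarith⟩⟩
    · intro t h1 h2 g hg
      have a := hy g hg
      rcases lt_or_gt_of_ne (hn' g hg) with h3 | h3
      · have := a.2.2 h3
        have := key' g hg h3
        exact ⟨⟨fun _ => by linarith, fun _ => by linarith⟩, ⟨fun _ => by linarith, fun _ => by linarith⟩⟩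
      · have := a.1.2 h3
        exact ⟨⟨fun _ => by linarith, fun _ => by linarith⟩, ⟨fun _ => by linarith, fun _ => by linarith⟩⟩
  · have key : ∀ g ∈ Γ, y < g.1 := fun g hg => by
      rcases lt_or_gt_of_ne (hn g hg) with h3 | h3
      · exact absurd ⟨g, Finset.mem_filter.2 ⟨hg, h3⟩⟩ hne
      · exact h3
    have key' : ∀ g ∈ Γ, y' < g.2 := fun g hg => (hy g hg).1.1 (key g hg)
    obtain ⟨N, hN⟩ := h.hb
    refine ⟨min N y - 1, by linarith [min_le_right N y], min N y' - 1,
      by linarith [min_le_right N y'], hN _ (by linarith [min_le_left N y]) _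
      (by linarith [min_le_left N y']), ?_, ?_⟩
    · intro t h1 h2 g hg
      have := key g hg
      have := key' g hg
      exact ⟨⟨fun _ => by linarith, fun _ => by linarith⟩, ⟨fun _ => by linarith, fun _ => by linarith⟩⟩
    · intro t h1 h2 g hg
      have := key g hg
      have := key' g hg
      exact ⟨⟨fun _ => by linarith, fun _ => by linarith⟩, ⟨fun _ => by linarith, fun _ => by linarith⟩⟩

lemma lt_of_deriv {P d : ℝ → ℝ} (hP : ∀ t, HasDerivAt P (d t) t) {a b : ℝ} (hab : a < b)
    (hd : ∀ t ∈ Ioo a b, 0 < d t) : P a < P b := by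
  obtain ⟨c, hc, e⟩ := exists_hasDerivAt_eq_slope P d hab
    (fun t _ => (hP t).continuousAt.continuousWithinAt) (fun t _ => hP t)
  have h1 := hd c hc
  rw [e, lt_div_iff₀ (by linarith)] at h1
  linarith

lemma exists_root {P : ℝ → ℝ} (hc : Continuous P) {a b : ℝ} (hab : a < b) (ha : P a < 0)
    (hb : 0 < P b) : ∃ r, a < r ∧ r < b ∧ P r = 0 := by
  obtain ⟨r, hr, e⟩ := intermediate_value_Ioo hab.le hc.continuousOn (show (0:ℝ) ∈ Ioo _ _ from ⟨ha, hb⟩)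
  exact ⟨r, hr.1, hr.2, e⟩

lemma sign_pos_iff' {a b : ℝ} (h : SignType.sign a = SignType.sign b) : 0 < a ↔ 0 < b := by
  rw [← sign_eq_one_iff, h, sign_eq_one_iff]
lemma sign_neg_iff' {a b : ℝ} (h : SignType.sign a = SignType.sign b) : a < 0 ↔ b < 0 := by
  rw [← sign_eq_neg_one_iff, h, sign_eq_neg_one_iff]
lemma sign_zero_iff' {a b : ℝ} (h : SignType.sign a = SignType.sign b) : a = 0 ↔ b = 0 := by
  rw [← sign_eq_zero_iff, h, sign_eq_zero_iff]

lemma St.contP {Γ : Finset (ℝ × ℝ)} {P P' d d' : ℝ → ℝ} (h : St Γ P P' d d') : Continuous P :=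
  continuous_iff_continuousAt.2 fun t => (h.hP t).continuousAt

lemma St.claim1_pos {Γ : Finset (ℝ × ℝ)} {P P' d d' : ℝ → ℝ} (h : St Γ P P' d d') {y y' : ℝ}
    (hy : SP Γ y y') (hn : ∀ g ∈ Γ, g.1 ≠ y) (h0 : P y = 0) (hd : 0 < d y) :
    ∃ r, P' r = 0 ∧ SP Γ y r := by
  obtain ⟨u, hu, u', hu', s1, a1, b1⟩ := h.right hy hn
  obtain ⟨v, hv, v', hv', s2, a2, b2⟩ := h.left hy hn
  have hd' : 0 < d' y' := (sign_pos_iff' (h.hd _ _ hy)).1 hd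
  have e1 : P y < P u := lt_of_deriv h.hP hu fun t ht =>
    (sign_pos_iff' (h.hd _ _ (a1 t ht.1.le ht.2))).2 hd'
  have e2 : P v < P y := lt_of_deriv h.hP hv fun t ht =>
    (sign_pos_iff' (h.hd _ _ (a2 t ht.2.le ht.1))).2 hd'
  have f1 : 0 < P' u' := (sign_pos_iff' s1).1 (by linarith)
  have f2 : P' v' < 0 := (sign_neg_iff' s2).1 (by linarith)
  obtain ⟨r, r1, r2, r0⟩ := exists_root h.swap.contP (by linarith) f2 f1
  refine ⟨r, r0, ?_⟩
  rcases le_total y' r with h3 | h3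
  · exact b1 r h3 r2
  · exact b2 r h3 r1

lemma St.claim1 {Γ : Finset (ℝ × ℝ)} {P P' d d' : ℝ → ℝ} (h : St Γ P P' d d') {y y' : ℝ}
    (hy : SP Γ y y') (h0 : P y = 0) : ∃ r, P' r = 0 ∧ SP Γ y r := by
  by_cases hn : ∀ g ∈ Γ, g.1 ≠ y
  · rcases lt_trichotomy (d y) 0 with h1 | h1 | h1
    · obtain ⟨r, r0, r1⟩ := h.neg.claim1_pos hy hn (by simpa using h0) (by simpa using h1)
      exact ⟨r, by simpa using r0, r1⟩
    · obtain ⟨g, hg, e⟩ := h.hr y h1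
      exact absurd e (hn g hg)
    · exact h.claim1_pos hy hn h0 h1
  · push Not at hn
    obtain ⟨g, hg, rfl⟩ := hn
    exact ⟨g.2, (sign_zero_iff' (h.hs g hg)).1 h0, h.cons g hg⟩

/-- sign comparison -/
lemma St.claim2 {Γ : Finset (ℝ × ℝ)} {P P' d d' : ℝ → ℝ} (h : St Γ P P' d d') {y y' : ℝ}
    (hy : SP Γ y y')
    (hm : ∀ r r', P r = 0 → P' r' = 0 → SP Γ r r' → (y < r ↔ y' < r') ∧ (r < y ↔ r' < y'))
    (h1 : 0 < P y) (h2 : P' y' < 0) : False := by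
  by_cases hn : ∀ g ∈ Γ, g.1 ≠ y
  · have hn' : ∀ g ∈ Γ, g.2 ≠ y' := fun g hg e => hn g hg ((SP_eq hy hg).2 e)
    rcases lt_trichotomy (d y) 0 with hd | hd | hd
    · obtain ⟨v, hv, v', hv', s2, a2, b2⟩ := h.left hy hn
      have hd' : d' y' < 0 := (sign_neg_iff' (h.hd _ _ hy)).1 hd
      have e2 : - P v < - P y := lt_of_deriv h.neg.hP hv fun t ht => by
        have := (sign_neg_iff' (h.hd _ _ (a2 t ht.2.le ht.1))).2 hd'
        linarith
      have f2 : 0 < P' v' := (sign_pos_iff' s2).1 (by linarith)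
      obtain ⟨r', r1, r2, r0⟩ := exists_root h.neg.swap.contP hv' (by linarith) (by linarith)
      have r0 : P' r' = 0 := by simpa using r0
      have hr' := b2 r' r2.le r1
      obtain ⟨r, q0, q1⟩ := h.swap.claim1 (SP_swap.2 hr') r0
      have q1 := SP_swap.1 q1
      have q2 := (hm r r' q0 r0 q1).2.2 r2
      have : - P r < - P y := lt_of_deriv h.neg.hP q2 fun t ht => by
        have : SP Γ t y' := by
          intro g hg
          have c1 := hy g hg
          have c2 := hr' g hg
          have c3 := q1 g hg
          rcases lt_or_gt_of_ne (hn g hg) with h3 | h3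
          · have := c1.2.1 h3
            have := c3.2.2 (c2.2.1 h3)
            exact ⟨⟨fun _ => by linarith [ht.1], fun _ => by linarith⟩, ⟨fun _ => by linarith, fun _ => by linarith [ht.1]⟩⟩
          · have := c1.1.1 h3
            exact ⟨⟨fun _ => by linarith [ht.1], fun _ => by linarith [ht.2]⟩, ⟨fun _ => by linarith [ht.2], fun _ => by linarith [ht.1]⟩⟩
        have := (sign_neg_iff' (h.hd _ _ this)).2 hd'
        linarith
      linarith
    · obtain ⟨g, hg, e⟩ := h.hr y hd
      exact absurd e (hn g hg)
    · obtain ⟨v, hv, v', hv', s2, a2, b2⟩ := h.right hy hn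
      have hd' : 0 < d' y' := (sign_pos_iff' (h.hd _ _ hy)).1 hd
      have e2 : P y < P v := lt_of_deriv h.hP hv fun t ht =>
        (sign_pos_iff' (h.hd _ _ (a2 t ht.1.le ht.2))).2 hd'
      have f2 : 0 < P' v' := (sign_pos_iff' s2).1 (by linarith)
      obtain ⟨r', r1, r2, r0⟩ := exists_root h.swap.contP hv' (by linarith) (by linarith)
      have hr' := b2 r' r1.le r2
      obtain ⟨r, q0, q1⟩ := h.swap.claim1 (SP_swap.2 hr') r0
      have q1 := SP_swap.1 q1
      have q2 := (hm r r' q0 r0 q1).1.2 r1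
      have : P y < P r := lt_of_deriv h.hP q2 fun t ht => by
        have : SP Γ t y' := by
          intro g hg
          have c1 := hy g hg
          have c2 := hr' g hg
          have c3 := q1 g hg
          rcases lt_or_gt_of_ne (hn g hg) with h3 | h3
          · have := c1.2.1 h3
            exact ⟨⟨fun _ => by linarith [ht.1], fun _ => by linarith⟩, ⟨fun _ => by linarith, fun _ => by linarith [ht.1]⟩⟩
          · have := c1.1.1 h3
            have := c3.1.2 (c2.1.1 h3)
            exact ⟨⟨fun _ => by linarith [ht.1], fun _ => by linarith [ht.2]⟩, ⟨fun _ => by linarith [ht.2], fun _ => by linarith [ht.1]⟩⟩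
        exact (sign_pos_iff' (h.hd _ _ this)).2 hd'
      linarith
  · push Not at hn
    obtain ⟨g, hg, rfl⟩ := hn
    have e := (SP_eq hy hg).1 rfl
    have := (sign_pos_iff' (h.hs g hg)).1 h1
    rw [e] at this
    linarith

lemma rolle' {P d : ℝ → ℝ} (hP : ∀ t, HasDerivAt P (d t) t) {a b : ℝ} (hab : a < b)
    (ha : P a = 0) (hb : P b = 0) : ∃ c, a < c ∧ c < b ∧ d c = 0 := by
  obtain ⟨c, hc, e⟩ := exists_hasDerivAt_eq_zero hab
    (fun t _ => (hP t).continuousAt.continuousWithinAt) (ha.trans hb.symm) (fun t _ => hP t)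
  exact ⟨c, hc.1, hc.2, e⟩

lemma St.step {Γ : Finset (ℝ × ℝ)} {P P' d d' : ℝ → ℝ} (h : St Γ P P' d d')
    (hf : {t | P t = 0}.Finite) (hf' : {t | P' t = 0}.Finite) :
    ∃ Γ' : Finset (ℝ × ℝ), Γ ⊆ Γ' ∧ (∀ g ∈ Γ', SP Γ' g.1 g.2) ∧
      ∀ y y', SP Γ' y y' → SignType.sign (P y) = SignType.sign (P' y') := by
  classical
  let Δ := (hf.toFinset ×ˢ hf'.toFinset).filter (fun g => SP Γ g.1 g.2)
  have hΔ : ∀ g, g ∈ Δ ↔ P g.1 = 0 ∧ P' g.2 = 0 ∧ SP Γ g.1 g.2 := by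
    intro g
    simp [Δ, and_assoc]
  refine ⟨Γ ∪ Δ, Finset.subset_union_left, ?_, ?_⟩
  · intro g hg k hk
    rcases Finset.mem_union.1 hg with hg | hg <;> rcases Finset.mem_union.1 hk with hk | hk
    · exact h.cons g hg k hk
    · have := ((hΔ k).1 hk).2.2 g hg
      exact ⟨this.2, this.1⟩
    · exact ((hΔ g).1 hg).2.2 k hk
    · rw [hΔ] at hg hk
      obtain ⟨g1, g2, g3⟩ := hg
      obtain ⟨k1, k2, k3⟩ := hk
      refine ⟨⟨fun hl => ?_, fun hl => ?_⟩, ⟨fun hl => ?_, fun hl => ?_⟩⟩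
      · obtain ⟨c, c1, c2, c0⟩ := rolle' h.hP hl g1 k1
        obtain ⟨e, he, rfl⟩ := h.hr c c0
        exact ((g3 e he).1.1 c1).trans ((k3 e he).2.1 c2)
      · obtain ⟨c, c1, c2, c0⟩ := rolle' h.hP' hl g2 k2
        obtain ⟨e, he, rfl⟩ := h.hr' c c0
        exact ((g3 e he).1.2 c1).trans ((k3 e he).2.2 c2)
      · obtain ⟨c, c1, c2, c0⟩ := rolle' h.hP hl k1 g1
        obtain ⟨e, he, rfl⟩ := h.hr c c0
        exact ((k3 e he).1.1 c1).trans ((g3 e he).2.1 c2)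
      · obtain ⟨c, c1, c2, c0⟩ := rolle' h.hP' hl k2 g2
        obtain ⟨e, he, rfl⟩ := h.hr' c c0
        exact ((k3 e he).1.2 c1).trans ((g3 e he).2.2 c2)
  · intro y y' hy
    have hy0 : SP Γ y y' := fun g hg => hy g (Finset.mem_union_left _ hg)
    have hm : ∀ r r', P r = 0 → P' r' = 0 → SP Γ r r' →
        (y < r ↔ y' < r') ∧ (r < y ↔ r' < y') := fun r r' h1 h2 h3 =>
      hy (r, r') (Finset.mem_union_right _ ((hΔ _).2 ⟨h1, h2, h3⟩))
    have hz : P y = 0 ↔ P' y' = 0 := by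
      constructor
      · intro h0
        obtain ⟨r, r0, r1⟩ := h.claim1 hy0 h0
        have := hm y r h0 r0 r1
        have : y' = r := by
          by_contra hne
          rcases lt_or_gt_of_ne hne with h3 | h3
          · exact lt_irrefl _ (this.1.2 h3)
          · exact lt_irrefl _ (this.2.2 h3)
        rw [this, r0]
      · intro h0
        obtain ⟨r, r0, r1⟩ := h.swap.claim1 (SP_swap.2 hy0) h0
        have := hm r y' r0 h0 (SP_swap.1 r1)
        have : y = r := by
          by_contra hne
          rcases lt_or_gt_of_ne hne with h3 | h3
          · exact lt_irrefl _ (this.1.1 h3)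
          · exact lt_irrefl _ (this.2.1 h3)
        rw [this, r0]
    rcases lt_trichotomy (P y) 0 with h1 | h1 | h1
    · rcases lt_trichotomy (P' y') 0 with h2 | h2 | h2
      · rw [sign_neg h1, sign_neg h2]
      · have := hz.2 h2; linarith
      · exact (h.neg.claim2 hy0 (by simpa using hm) (by simpa using h1) (by simpa using h2)).elim
    · rw [h1, hz.1 h1]
    · rcases lt_trichotomy (P' y') 0 with h2 | h2 | h2
      · exact (h.claim2 hy0 hm h1 h2).elim
      · have := hz.2 h2; linarith
      · rw [sign_pos h1, sign_pos h2]

lemma roots_in {Γ : Finset (ℝ × ℝ)} (hΓ : ∀ g ∈ Γ, SP Γ g.1 g.2) {l l' : Polynomial ℝ}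
    (h : ∀ y y', SP Γ y y' → SignType.sign (l.eval y) = SignType.sign (l'.eval y'))
    (hl : l ≠ 0) {w : ℝ} (hw : l.eval w = 0) : ∃ g ∈ Γ, g.1 = w := by
  by_contra hn
  push Not at hn
  obtain ⟨w', hw'⟩ := SP_exists hΓ w
  have h0 : l'.eval w' = 0 := (sign_zero_iff' (h w w' hw')).1 hw
  have ev : ∀ᶠ t in nhds w, ∀ g ∈ Γ, (t < g.1 ↔ w' < g.2) ∧ (g.1 < t ↔ g.2 < w') := by
    rw [Filter.eventually_all_finset]
    intro g hg
    have := hw' g hg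
    rcases lt_or_gt_of_ne (hn g hg) with h3 | h3
    · filter_upwards [lt_mem_nhds h3] with t ht
      have := this.2.1 h3
      exact ⟨⟨fun _ => by linarith, fun _ => by linarith⟩, ⟨fun _ => by linarith, fun _ => by linarith⟩⟩
    · filter_upwards [gt_mem_nhds h3] with t ht
      have := this.1.1 h3
      exact ⟨⟨fun _ => by linarith, fun _ => by linarith⟩, ⟨fun _ => by linarith, fun _ => by linarith⟩⟩
  apply hl
  apply Polynomial.eq_zero_of_infinite_isRoot
  refine (infinite_of_mem_nhds w ev).mono ?_
  intro t ht
  exact (sign_zero_iff' (h t w' ht)).2 h0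

lemma zero_of_match {Γ : Finset (ℝ × ℝ)} (hΓ : ∀ g ∈ Γ, SP Γ g.1 g.2) {l l' : Polynomial ℝ}
    (h : ∀ y y', SP Γ y y' → SignType.sign (l.eval y) = SignType.sign (l'.eval y'))
    (hl : l' = 0) : l = 0 := by
  apply Polynomial.funext
  intro y
  obtain ⟨y', hy⟩ := SP_exists hΓ y
  have := h y y' hy
  rw [hl] at this
  simpa using (sign_zero_iff' this).2 (by simp)

lemma cons_swap {Γ : Finset (ℝ × ℝ)} (hΓ : ∀ g ∈ Γ, SP Γ g.1 g.2) :
    ∀ g ∈ Γ.image Prod.swap, SP (Γ.image Prod.swap) g.1 g.2 := by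
  intro g hg
  obtain ⟨g, hg1, rfl⟩ := Finset.mem_image.1 hg
  exact SP_swap.2 (hΓ g hg1)

lemma roots_in' {Γ : Finset (ℝ × ℝ)} (hΓ : ∀ g ∈ Γ, SP Γ g.1 g.2) {l l' : Polynomial ℝ}
    (h : ∀ y y', SP Γ y y' → SignType.sign (l.eval y) = SignType.sign (l'.eval y'))
    (hl : l' ≠ 0) {w : ℝ} (hw : l'.eval w = 0) : ∃ g ∈ Γ, g.2 = w := by
  obtain ⟨g, hg, e⟩ := roots_in (cons_swap hΓ) (l := l') (l' := l)
    (fun y y' hy => (h y' y (SP_swap.1 hy)).symm) hl hw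
  obtain ⟨g, hg1, rfl⟩ := Finset.mem_image.1 hg
  exact ⟨g, hg1, e⟩

lemma root_between (l : Polynomial ℝ) {a b : ℝ}
    (h : SignType.sign (l.eval a) ≠ SignType.sign (l.eval b)) :
    ∃ w ∈ uIcc a b, l.eval w = 0 := by
  have : (0:ℝ) ∈ uIcc (l.eval a) (l.eval b) := by
    rw [mem_uIcc]
    by_contra hc
    push Not at hc
    apply h
    rcases lt_trichotomy (l.eval a) 0 with h1 | h1 | h1
    · have := hc.1 h1.le
      rw [sign_neg h1, sign_neg this]
    · have := hc.1 h1.le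
      have := hc.2
      rcases le_total (l.eval b) 0 with h3 | h3
      · have := hc.2 h3; linarith
      · linarith
    · have : 0 < l.eval b := by
        by_contra h3
        have := hc.2 (not_lt.1 h3); linarith
      rw [sign_pos h1, sign_pos this]
  obtain ⟨w, hw, e⟩ := intermediate_value_uIcc (f := fun t => l.eval t) l.continuous.continuousOn this
  exact ⟨w, hw, e⟩

lemma shrink {ι : Type*} (G : Finset ι) (l l' : ι → Polynomial ℝ) {Γ : Finset (ℝ × ℝ)}
    (hΓ : ∀ g ∈ Γ, SP Γ g.1 g.2)
    (h : ∀ y y', SP Γ y y' → ∀ i ∈ G, SignType.sign ((l i).eval y) = SignType.sign ((l' i).eval y')) :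
    ∃ Γ' ⊆ Γ, (∀ g ∈ Γ', ∃ i ∈ G, l i ≠ 0 ∧ (l i).eval g.1 = 0) ∧
      (∀ g ∈ Γ', SP Γ' g.1 g.2) ∧
      ∀ y y', SP Γ' y y' → ∀ i ∈ G, SignType.sign ((l i).eval y) = SignType.sign ((l' i).eval y') := by
  classical
  refine ⟨Γ.filter (fun g => ∃ i ∈ G, l i ≠ 0 ∧ (l i).eval g.1 = 0), Finset.filter_subset _ _,
    fun g hg => (Finset.mem_filter.1 hg).2, ?_, ?_⟩
  · intro g hg k hk
    exact hΓ g (Finset.mem_filter.1 hg).1 k (Finset.mem_filter.1 hk).1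
  · intro y y' hy i hi
    obtain ⟨z, hz⟩ := SP_exists hΓ y
    rw [h y z hz i hi]
    by_contra hne
    have hm : ∀ y y', SP Γ y y' → SignType.sign ((l i).eval y) = SignType.sign ((l' i).eval y') :=
      fun y y' hy => h y y' hy i hi
    have hl' : l' i ≠ 0 := fun e => hne (by simp [e])
    have hl : l i ≠ 0 := fun e => hl' (zero_of_match (cons_swap hΓ) (l' := l i)
      (fun y y' hy => (hm y' y (SP_swap.1 hy)).symm) e)
    obtain ⟨w, hw, w0⟩ := root_between (l' i) hne
    obtain ⟨g, hg, rfl⟩ := roots_in' hΓ hm hl' w0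
    have g0 : (l i).eval g.1 = 0 := (sign_zero_iff' (hm _ _ (hΓ g hg))).2 w0
    have a1 := hz g hg
    have a2 := hy g (Finset.mem_filter.2 ⟨hg, i, hi, hl, g0⟩)
    have b1 : z < g.2 ↔ y' < g.2 := a1.1.symm.trans a2.1
    have b2 : g.2 < z ↔ g.2 < y' := a1.2.symm.trans a2.2
    rcases mem_uIcc.1 hw with h3 | h3
    · have c1 : z = g.2 := le_antisymm h3.1 (by
        by_contra h5; have := b1.1 (not_le.1 h5); linarith)
      have c2 : y' = g.2 := le_antisymm (by
        by_contra h5; have := b2.2 (not_le.1 h5); linarith) h3.2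
      exact hne (by rw [c1, c2])
    · have c1 : z = g.2 := le_antisymm (by
        by_contra h5; have := b2.1 (not_le.1 h5); linarith) h3.2
      have c2 : y' = g.2 := le_antisymm h3.1 (by
        by_contra h5; have := b1.2 (not_le.1 h5); linarith)
      exact hne (by rw [c1, c2])

lemma sign_top {P : Polynomial ℝ} (h : 0 < P.natDegree) :
    ∃ N, ∀ t ≥ N, SignType.sign (P.eval t) = SignType.sign P.leadingCoeff := by
  have hd := Polynomial.natDegree_pos_iff_degree_pos.1 h
  have h0 : P.leadingCoeff ≠ 0 := fun e => by
    rw [Polynomial.leadingCoeff_eq_zero] at e; simp [e] at h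
  rw [← Filter.eventually_atTop]
  rcases lt_or_gt_of_ne h0 with h1 | h1
  · filter_upwards [(P.tendsto_atBot_of_leadingCoeff_nonpos hd h1.le).eventually_lt_atBot 0] with t ht
    rw [sign_neg h1, sign_neg ht]
  · filter_upwards [(P.tendsto_atTop_of_leadingCoeff_nonneg hd h1.le).eventually_gt_atTop 0] with t ht
    rw [sign_pos h1, sign_pos ht]

lemma sign_bot {P : Polynomial ℝ} (h : 0 < P.natDegree) :
    ∃ N, ∀ t ≤ N, SignType.sign (P.eval t) = SignType.sign (P.leadingCoeff * (-1) ^ P.natDegree) := by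
  have h1 : (P.comp (-Polynomial.X)).natDegree = P.natDegree := by
    rw [Polynomial.natDegree_comp]; simp
  obtain ⟨N, hN⟩ := sign_top (P := P.comp (-Polynomial.X)) (by rw [h1]; exact h)
  refine ⟨-N, fun t ht => ?_⟩
  have := hN (-t) (by linarith)
  rw [Polynomial.leadingCoeff_comp (by simp)] at this
  simpa using this

lemma pdiv {A : Type*} [CommRing A] (g : Polynomial A) (k : ℕ) (hk : 1 ≤ k) (hg : g.natDegree ≤ k)
    (d : ℕ) : ∀ p : Polynomial A, p.natDegree ≤ d → ∃ (e : ℕ) (Q R : Polynomial A),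
      Polynomial.C (g.coeff k ^ e) * p = Q * g + R ∧ R.natDegree ≤ k - 1 := by
  induction d with
  | zero => exact fun p hp => ⟨0, 0, p, by simp, by omega⟩
  | succ d ih =>
    intro p hp
    by_cases hd : d + 1 ≤ k - 1
    · exact ⟨0, 0, p, by simp, by omega⟩
    · have hc : (Polynomial.C (g.coeff k) * p -
          Polynomial.C (p.coeff (d+1)) * Polynomial.X ^ (d + 1 - k) * g).natDegree ≤ d := by
        rw [Polynomial.natDegree_le_iff_coeff_eq_zero]
        intro N hN
        rw [Polynomial.coeff_sub, Polynomial.coeff_C_mul, mul_assoc, Polynomial.coeff_C_mul]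
        obtain ⟨j, rfl⟩ : ∃ j, N = j + (d + 1 - k) := ⟨N - (d+1-k), by omega⟩
        rw [Polynomial.coeff_X_pow_mul]
        by_cases hj : j = k
        · subst hj
          have : j + (d + 1 - j) = d + 1 := by omega
          rw [this]; ring
        · rw [Polynomial.coeff_eq_zero_of_natDegree_lt (p := g) (n := j) (by omega),
            Polynomial.coeff_eq_zero_of_natDegree_lt (p := p) (by omega)]
          simp
      obtain ⟨e, Q, R, h1, h2⟩ := ih _ hc
      refine ⟨e + 1, Q + Polynomial.C (g.coeff k ^ e) *
        (Polynomial.C (p.coeff (d+1)) * Polynomial.X ^ (d + 1 - k)), R, ?_, h2⟩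
      rw [pow_succ, Polynomial.C_mul]
      linear_combination h1

lemma prem_exists {A : Type*} [CommRing A] (p g : Polynomial A) (k : ℕ) :
    ∃ R : Polynomial A, R.natDegree ≤ k - 1 ∧ (1 ≤ k → g.natDegree ≤ k →
      ∀ (φ : A →+* ℝ) (z : ℝ), φ (g.coeff k) ≠ 0 → (g.map φ).eval z = 0 →
      SignType.sign ((p.map φ).eval z) = SignType.sign ((R.map φ).eval z)) := by
  by_cases h : 1 ≤ k ∧ g.natDegree ≤ k
  · obtain ⟨e, Q, R, h1, h2⟩ := pdiv g k h.1 h.2 _ p le_rfl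
    refine ⟨Polynomial.C (g.coeff k ^ e) * R, (Polynomial.natDegree_C_mul_le _ _).trans h2, ?_⟩
    intro _ _ φ z hc hz
    have h3 : ((Polynomial.C (g.coeff k ^ e) * p).map φ).eval z = ((Q * g + R).map φ).eval z := by
      rw [h1]
    simp only [Polynomial.map_mul, Polynomial.map_add, Polynomial.eval_mul, Polynomial.eval_add,
      hz, Polynomial.map_C, Polynomial.eval_C, mul_zero, zero_add] at h3 ⊢
    rw [← h3, ← mul_assoc, sign_mul, map_pow, sign_pos (a := φ (g.coeff k) ^ e * φ (g.coeff k) ^ e)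
      (mul_self_pos.2 (pow_ne_zero _ hc)), one_mul]
  · exact ⟨0, by simp, fun h1 h2 => absurd ⟨h1, h2⟩ h⟩

noncomputable def prem {A : Type*} [CommRing A] (p g : Polynomial A) (k : ℕ) : Polynomial A :=
  (prem_exists p g k).choose

noncomputable def tr {A : Type*} [CommRing A] (k : ℕ) (l : Polynomial A) : Polynomial A :=
  ∑ i ∈ Finset.range (k + 1), Polynomial.monomial i (l.coeff i)

lemma tr_coeff {A : Type*} [CommRing A] (k : ℕ) (l : Polynomial A) (i : ℕ) :
    (tr k l).coeff i = if i ≤ k then l.coeff i else 0 := by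
  simp only [tr, Polynomial.finsetSum_coeff, Polynomial.coeff_monomial]
  rw [Finset.sum_ite_eq']
  simp

lemma tr_deg {A : Type*} [CommRing A] (k : ℕ) (l : Polynomial A) : (tr k l).natDegree ≤ k := by
  rw [Polynomial.natDegree_le_iff_coeff_eq_zero]
  intro N hN
  rw [tr_coeff, if_neg (by omega)]

lemma tr_map {A : Type*} [CommRing A] (k : ℕ) (l : Polynomial A) (φ : A →+* ℝ)
    (h : (l.map φ).natDegree ≤ k) : (tr k l).map φ = l.map φ := by
  ext i
  rw [Polynomial.coeff_map, tr_coeff]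
  split_ifs with h1
  · rw [Polynomial.coeff_map]
  · rw [map_zero, Polynomial.coeff_eq_zero_of_natDegree_lt (by omega)]

def EqL {A : Type*} [CommRing A] (φ φ' : A →+* ℝ) (L : Finset (Polynomial A)) : Prop :=
  ∃ Γ : Finset (ℝ × ℝ), (∀ g ∈ Γ, SP Γ g.1 g.2) ∧ ∀ y y', SP Γ y y' → ∀ l ∈ L,
    SignType.sign ((l.map φ).eval y) = SignType.sign ((l.map φ').eval y')

def Elim {A : Type*} [CommRing A] (L : Finset (Polynomial A)) : Prop :=
  ∃ M : Finset A, ∀ φ φ' : A →+* ℝ,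
    (∀ m ∈ M, SignType.sign (φ m) = SignType.sign (φ' m)) → EqL φ φ' L

lemma natDegree_same {A : Type*} [CommRing A] {φ φ' : A →+* ℝ} {l : Polynomial A}
    (h : ∀ i ≤ l.natDegree, SignType.sign (φ (l.coeff i)) = SignType.sign (φ' (l.coeff i))) :
    (l.map φ).natDegree = (l.map φ').natDegree := by
  have : (l.map φ).support = (l.map φ').support := by
    ext i
    rw [Polynomial.mem_support_iff, Polynomial.mem_support_iff, Polynomial.coeff_map,
      Polynomial.coeff_map]
    by_cases hi : i ≤ l.natDegree
    · exact not_congr (sign_zero_iff' (h i hi))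
    · rw [Polynomial.coeff_eq_zero_of_natDegree_lt (by omega)]; simp
  rw [Polynomial.natDegree, Polynomial.natDegree, Polynomial.degree, Polynomial.degree, this]

open Classical in
lemma elim_step {A : Type*} [CommRing A] (D : ℕ) (L : Finset (Polynomial A)) (p : Polynomial A)
    (hL : ∀ l ∈ L, l.natDegree ≤ D + 1) (hp : p.natDegree ≤ D + 1)
    (h1 : Elim (insert (p - Polynomial.monomial (D+1) (p.coeff (D+1))) L))
    (h2 : Elim ((insert p.derivative L) ∪
      ((insert p.derivative L) ×ˢ Finset.range (D+2)).image (fun x => prem p (tr x.2 x.1) x.2))) :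
    Elim (insert p L) := by
  obtain ⟨M1, h1⟩ := h1
  obtain ⟨M2, h2⟩ := h2
  set G := insert p.derivative L with hGdef
  refine ⟨M1 ∪ M2 ∪ ((insert p G) ×ˢ Finset.range (D+2)).image (fun x => x.1.coeff x.2), ?_⟩
  intro φ φ' hM
  have hM1 := h1 φ φ' fun m hm => hM m (by simp [hm])
  have hM2 := h2 φ φ' fun m hm => hM m (by simp [hm])
  have hco : ∀ l ∈ insert p G, ∀ i ≤ D + 1,
      SignType.sign (φ (l.coeff i)) = SignType.sign (φ' (l.coeff i)) := fun l hl i hi =>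
    hM _ (Finset.mem_union_right _ (Finset.mem_image.2 ⟨(l, i), Finset.mem_product.2
      ⟨hl, Finset.mem_range.2 (by omega)⟩, rfl⟩))
  have hpd : p.derivative.natDegree ≤ D := (Polynomial.natDegree_derivative_le p).trans (by omega)
  have hG : ∀ l ∈ G, l.natDegree ≤ D + 1 := by
    intro l hl
    rcases Finset.mem_insert.1 hl with rfl | hl
    · omega
    · exact hL l hl
  have hlead := hco p (Finset.mem_insert_self _ _) (D+1) le_rfl
  by_cases h0 : φ (p.coeff (D+1)) = 0
  · have h0' := (sign_zero_iff' hlead).1 h0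
    obtain ⟨Γ, c1, c2⟩ := hM1
    refine ⟨Γ, c1, fun y y' hy l hl => ?_⟩
    rcases Finset.mem_insert.1 hl with rfl | hl
    · have := c2 y y' hy _ (Finset.mem_insert_self _ _)
      simpa [Polynomial.map_sub, Polynomial.map_monomial, h0, h0'] using this
    · exact c2 y y' hy l (Finset.mem_insert_of_mem hl)
  · have h0' : φ' (p.coeff (D+1)) ≠ 0 := fun e => h0 ((sign_zero_iff' hlead).2 e)
    have dg : ∀ ψ : A →+* ℝ, ψ (p.coeff (D+1)) ≠ 0 → (p.map ψ).natDegree = D + 1 := fun ψ hψ =>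
      le_antisymm ((Polynomial.natDegree_map_le).trans hp)
        (Polynomial.le_natDegree_of_ne_zero (by rwa [Polynomial.coeff_map]))
    have dnz : ∀ ψ : A →+* ℝ, ψ (p.coeff (D+1)) ≠ 0 → p.derivative.map ψ ≠ 0 := fun ψ hψ e => by
      rw [← Polynomial.derivative_map] at e
      have := Polynomial.derivative_eq_zero.1 e
      rw [dg ψ hψ] at this
      omega
    have pnz : ∀ ψ : A →+* ℝ, ψ (p.coeff (D+1)) ≠ 0 → p.map ψ ≠ 0 := fun ψ hψ e => by
      have := dg ψ hψ
      rw [e] at this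
      simp at this
    have hlc : SignType.sign (p.map φ).leadingCoeff = SignType.sign (p.map φ').leadingCoeff := by
      rw [Polynomial.leadingCoeff, Polynomial.leadingCoeff, dg φ h0, dg φ' h0',
        Polynomial.coeff_map, Polynomial.coeff_map, hlead]
    obtain ⟨Γ, c1, c2⟩ := hM2
    obtain ⟨Γ0, s1, s2, s3, s4⟩ := shrink G (fun l => l.map φ) (fun l => l.map φ') c1
      (fun y y' hy l hl => c2 y y' hy l (Finset.mem_union_left _ hl))
    have hder : p.derivative ∈ G := Finset.mem_insert_self _ _
    have st : St Γ0 (fun t => (p.map φ).eval t) (fun t => (p.map φ').eval t)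
        (fun t => (p.derivative.map φ).eval t) (fun t => (p.derivative.map φ').eval t) := by
      refine ⟨?_, ?_, s3, fun y y' hy => s4 y y' hy _ hder, ?_, ?_, ?_, ?_, ?_⟩
      · intro t; rw [← Polynomial.derivative_map]; exact (p.map φ).hasDerivAt t
      · intro t; rw [← Polynomial.derivative_map]; exact (p.map φ').hasDerivAt t
      · intro y hy
        exact roots_in s3 (fun y y' hy => s4 y y' hy _ hder) (dnz φ h0) hy
      · intro y hy
        exact roots_in' s3 (fun y y' hy => s4 y y' hy _ hder) (dnz φ' h0') hy
      · intro g hg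
        obtain ⟨l, hl, l0, l1⟩ := s2 g hg
        have l2 : (l.map φ').eval g.2 = 0 := (sign_zero_iff' (s4 _ _ (s3 g hg) l hl)).1 l1
        have hdeg : (l.map φ).natDegree = (l.map φ').natDegree := natDegree_same fun i hi =>
          hco l (Finset.mem_insert_of_mem hl) i (hi.trans (hG l hl))
        set k := (l.map φ).natDegree with hk
        have hk1 : 1 ≤ k := by
          by_contra hlt
          have e := Polynomial.eq_C_of_natDegree_eq_zero (show (l.map φ).natDegree = 0 by omega)
          rw [e, Polynomial.eval_C] at l1
          rw [l1, Polynomial.C_0] at e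
          exact l0 e
        have hk2 : k ≤ D + 1 := Polynomial.natDegree_map_le.trans (hG l hl)
        have hkc : φ (l.coeff k) ≠ 0 := by
          rw [← Polynomial.coeff_map, hk]
          exact fun e => l0 (Polynomial.leadingCoeff_eq_zero.1 e)
        have hkc' : φ' (l.coeff k) ≠ 0 := fun e => hkc ((sign_zero_iff'
          (hco l (Finset.mem_insert_of_mem hl) k hk2)).2 e)
        have hR := (prem_exists p (tr k l) k).choose_spec.2 hk1 (tr_deg k l)
        have m1 := hR φ g.1 (by rw [tr_coeff, if_pos le_rfl]; exact hkc)
          (by rw [tr_map k l φ le_rfl]; exact l1)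
        have m2 := hR φ' g.2 (by rw [tr_coeff, if_pos le_rfl]; exact hkc')
          (by rw [tr_map k l φ' hdeg.ge]; exact l2)
        have m3 := c2 g.1 g.2 (c1 g (s1 hg)) (prem p (tr k l) k) (Finset.mem_union_right _
          (Finset.mem_image.2 ⟨(l, k), Finset.mem_product.2
            ⟨hl, Finset.mem_range.2 (by omega)⟩, rfl⟩))
        exact m1.trans (m3.trans m2.symm)
      · obtain ⟨N, hN⟩ := sign_top (P := p.map φ) (by rw [dg φ h0]; omega)
        obtain ⟨N', hN'⟩ := sign_top (P := p.map φ') (by rw [dg φ' h0']; omega)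
        refine ⟨max N N', fun t ht t' ht' => ?_⟩
        rw [hN t ((le_max_left _ _).trans ht), hN' t' ((le_max_right _ _).trans ht'), hlc]
      · obtain ⟨N, hN⟩ := sign_bot (P := p.map φ) (by rw [dg φ h0]; omega)
        obtain ⟨N', hN'⟩ := sign_bot (P := p.map φ') (by rw [dg φ' h0']; omega)
        refine ⟨min N N', fun t ht t' ht' => ?_⟩
        rw [hN t (ht.trans (min_le_left _ _)), hN' t' (ht'.trans (min_le_right _ _)),
          sign_mul, sign_mul, hlc, dg φ h0, dg φ' h0']
    obtain ⟨Γ', t1, t2, t3⟩ := st.step (Polynomial.finite_setOfPred_isRoot (pnz φ h0))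
      (Polynomial.finite_setOfPred_isRoot (pnz φ' h0'))
    refine ⟨Γ', t2, fun y y' hy l hl => ?_⟩
    rcases Finset.mem_insert.1 hl with rfl | hl
    · exact t3 y y' hy
    · exact s4 y y' (fun g hg => hy g (t1 hg)) l (Finset.mem_insert_of_mem hl)

open Classical in
lemma elim_aux {A : Type*} [CommRing A] (D : ℕ)
    (ih : ∀ L : Finset (Polynomial A), (∀ l ∈ L, l.natDegree ≤ D) → Elim L)
    (T : Finset (Polynomial A)) : (∀ l ∈ T, l.natDegree ≤ D + 1) →
    ∀ L : Finset (Polynomial A), (∀ l ∈ L, l.natDegree ≤ D) → Elim (T ∪ L) := by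
  induction T using Finset.induction_on with
  | empty => intro _ L hL; simpa using ih L hL
  | insert p T _ ihT =>
    intro hT L hL
    have hT' : ∀ l ∈ T, l.natDegree ≤ D + 1 := fun l hl => hT l (Finset.mem_insert_of_mem hl)
    have hp := hT p (Finset.mem_insert_self _ _)
    have hTL : ∀ l ∈ T ∪ L, l.natDegree ≤ D + 1 := fun l hl => by
      rcases Finset.mem_union.1 hl with hl | hl
      · exact hT' l hl
      · exact (hL l hl).trans (by omega)
    have hpd : p.derivative.natDegree ≤ D := (Polynomial.natDegree_derivative_le p).trans (by omega)
    rw [Finset.insert_union]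
    refine elim_step D (T ∪ L) p hTL hp ?_ ?_
    · rw [← Finset.union_insert]
      refine ihT hT' _ ?_
      intro l hl
      rcases Finset.mem_insert.1 hl with rfl | hl
      · rw [Polynomial.natDegree_le_iff_coeff_eq_zero]
        intro N hN
        rw [Polynomial.coeff_sub, Polynomial.coeff_monomial]
        split_ifs with h
        · rw [h, sub_self]
        · rw [Polynomial.coeff_eq_zero_of_natDegree_lt (by omega), sub_zero]
      · exact hL l hl
    · rw [← Finset.union_insert, Finset.union_assoc]
      refine ihT hT' _ ?_
      intro l hl
      rcases Finset.mem_union.1 hl with hl | hl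
      · rcases Finset.mem_insert.1 hl with rfl | hl
        · exact hpd
        · exact hL l hl
      · obtain ⟨x, hx, rfl⟩ := Finset.mem_image.1 hl
        have h1 := Finset.mem_range.1 (Finset.mem_product.1 hx).2
        exact ((prem_exists p (tr x.2 x.1) x.2).choose_spec.1).trans (by omega)

lemma elim_all {A : Type*} [CommRing A] (D : ℕ) :
    ∀ L : Finset (Polynomial A), (∀ l ∈ L, l.natDegree ≤ D) → Elim L := by
  classical
  induction D with
  | zero =>
    intro L hL
    refine ⟨L.image (fun l => l.coeff 0), fun φ φ' h => ⟨∅, by simp, fun y y' _ l hl => ?_⟩⟩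
    have e := Polynomial.eq_C_of_natDegree_eq_zero (Nat.le_zero.1 (hL l hl))
    rw [e]
    simpa using h _ (Finset.mem_image_of_mem _ hl)
  | succ D ih =>
    intro L hL
    simpa using elim_aux D ih L hL ∅ (by simp)

lemma elim_one {A : Type*} [CommRing A] (L : Finset (Polynomial A)) :
    ∃ M : Finset A, ∀ φ φ' : A →+* ℝ,
    (∀ m ∈ M, SignType.sign (φ m) = SignType.sign (φ' m)) → ∀ y : ℝ, ∃ y' : ℝ, ∀ l ∈ L,
    SignType.sign ((l.map φ).eval y) = SignType.sign ((l.map φ').eval y') := by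
  obtain ⟨M, hM⟩ := elim_all (L.sup Polynomial.natDegree) L (fun l hl => Finset.le_sup hl)
  refine ⟨M, fun φ φ' h y => ?_⟩
  obtain ⟨Γ, c1, c2⟩ := hM φ φ' h
  obtain ⟨y', hy⟩ := SP_exists c1 y
  exact ⟨y', c2 y y' hy⟩

lemma elim_multi {K : Type*} [CommRing K] (n : ℕ) (L : Finset (MvPolynomial (Fin n) K)) :
    ∃ M : Finset K, ∀ φ φ' : K →+* ℝ,
    (∀ m ∈ M, SignType.sign (φ m) = SignType.sign (φ' m)) → ∀ x : Fin n → ℝ, ∃ x' : Fin n → ℝ,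
    ∀ l ∈ L, SignType.sign (MvPolynomial.eval₂ φ x l) = SignType.sign (MvPolynomial.eval₂ φ' x' l) := by
  classical
  induction n with
  | zero =>
    refine ⟨L.image (MvPolynomial.coeff 0), fun φ φ' h x => ⟨x, fun l hl => ?_⟩⟩
    have e := MvPolynomial.eq_C_of_isEmpty l
    rw [e, MvPolynomial.eval₂_C, MvPolynomial.eval₂_C]
    exact h _ (Finset.mem_image_of_mem _ hl)
  | succ n ih =>
    obtain ⟨M1, h1⟩ := elim_one (L.image (MvPolynomial.finSuccEquiv K n))
    obtain ⟨M, hM⟩ := ih M1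
    refine ⟨M, fun φ φ' h x => ?_⟩
    obtain ⟨z, hz⟩ := hM φ φ' h (fun i => x i.succ)
    obtain ⟨y, hy⟩ := h1 (MvPolynomial.eval₂Hom φ (fun i => x i.succ)) (MvPolynomial.eval₂Hom φ' z)
      (fun m hm => hz m hm) (x 0)
    have key : ∀ (ψ : K →+* ℝ) (a : ℝ) (b : Fin n → ℝ) (l : MvPolynomial (Fin (n+1)) K),
        (((MvPolynomial.finSuccEquiv K n l).map (MvPolynomial.eval₂Hom ψ b)).eval a) =
        MvPolynomial.eval₂ ψ (Fin.cons a b : Fin (n+1) → ℝ) l := by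
      intro ψ a b l
      induction l using MvPolynomial.induction_on with
      | C r => simp [MvPolynomial.finSuccEquiv_apply]
      | add p q hp hq => simp only [map_add, Polynomial.map_add, Polynomial.eval_add, hp, hq, MvPolynomial.eval₂_add]
      | mul_X p i hp =>
        simp only [map_mul, Polynomial.map_mul, Polynomial.eval_mul, hp, MvPolynomial.eval₂_mul, MvPolynomial.eval₂_X]
        congr 1
        refine Fin.cases ?_ (fun j => ?_) i
        · simp [MvPolynomial.finSuccEquiv_X_zero]
        · simp [MvPolynomial.finSuccEquiv_X_succ]
    refine ⟨Fin.cons y z, fun l hl => ?_⟩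
    have := hy _ (Finset.mem_image_of_mem _ hl)
    rw [key, key] at this
    have e : (Fin.cons (x 0) (fun i => x i.succ) : Fin (n+1) → ℝ) = x := Fin.cons_self_tail x
    rwa [e] at this

def Bd (F : ℝ → ℝ → ℝ) : Prop :=
  ∃ (c : ℝ) (N : ℕ), 0 ≤ c ∧ ∀ u e, 1 ≤ u → 0 < e → e ≤ 1 → |F u e| ≤ c * u ^ N

lemma Bd.add {F G : ℝ → ℝ → ℝ} (hF : Bd F) (hG : Bd G) : Bd (fun u e => F u e + G u e) := by
  obtain ⟨c, N, hc, h⟩ := hF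
  obtain ⟨c', N', hc', h'⟩ := hG
  refine ⟨c + c', N + N', by positivity, fun u e h1 h2 h3 => ?_⟩
  have a := h u e h1 h2 h3
  have a' := h' u e h1 h2 h3
  have b : c * u ^ N ≤ c * u ^ (N + N') := by gcongr; omega
  have b' : c' * u ^ N' ≤ c' * u ^ (N + N') := by gcongr; omega
  have := abs_add_le (F u e) (G u e)
  nlinarith

lemma Bd.mul {F G : ℝ → ℝ → ℝ} (hF : Bd F) (hG : Bd G) : Bd (fun u e => F u e * G u e) := by
  obtain ⟨c, N, hc, h⟩ := hF
  obtain ⟨c', N', hc', h'⟩ := hG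
  refine ⟨c * c', N + N', by positivity, fun u e h1 h2 h3 => ?_⟩
  have a := h u e h1 h2 h3
  have a' := h' u e h1 h2 h3
  rw [abs_mul]
  calc |F u e| * |G u e| ≤ (c * u ^ N) * (c' * u ^ N') := by gcongr
    _ = _ := by ring

noncomputable def ev (u e : ℝ) : Polynomial (Polynomial ℝ) →+* ℝ :=
  Polynomial.eval₂RingHom (Polynomial.evalRingHom u) e

lemma Bd_const (a : ℝ) : Bd (fun _ _ => a) := ⟨|a|, 0, abs_nonneg _, by simp⟩

lemma Bd_pow {F : ℝ → ℝ → ℝ} (hF : Bd F) (n : ℕ) : Bd (fun u e => F u e ^ n) := by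
  induction n with
  | zero => simpa using Bd_const 1
  | succ n ih => simpa [pow_succ] using ih.mul hF

lemma Bd_inner (q : Polynomial ℝ) : Bd (fun u _ => q.eval u) := by
  induction q using Polynomial.induction_on' with
  | add p q hp hq => simpa using hp.add hq
  | monomial n a =>
    have h : Bd (fun u _ => u) := ⟨1, 1, by norm_num, fun u e h1 _ _ => by
      rw [abs_of_nonneg (by linarith)]; simp⟩
    simpa using (Bd_const a).mul (Bd_pow h n)

lemma Bd_ev (Q : Polynomial (Polynomial ℝ)) : Bd (fun u e => ev u e Q) := by
  induction Q using Polynomial.induction_on' with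
  | add p q hp hq => simpa using hp.add hq
  | monomial n a =>
    have h : Bd (fun _ e => e) := ⟨1, 0, by norm_num, fun u e h1 h2 h3 => by
      rw [abs_of_nonneg (by linarith)]; simpa using h3⟩
    simpa [ev, Polynomial.eval₂_monomial] using (Bd_inner a).mul (Bd_pow h n)

lemma low_bd {q : Polynomial ℝ} (hq : q ≠ 0) : ∃ δ > 0, ∃ u0, ∀ u ≥ u0, δ ≤ |q.eval u| := by
  by_cases h : 0 < q.degree
  · have := (q.abs_tendsto_atTop h).eventually_ge_atTop 1
    rw [Filter.eventually_atTop] at this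
    exact ⟨1, one_pos, this⟩
  · have e := Polynomial.eq_C_of_degree_le_zero (not_lt.1 h)
    have h0 : q.coeff 0 ≠ 0 := fun h0 => hq (by rw [e, h0, Polynomial.C_0])
    refine ⟨|q.coeff 0|, abs_pos.2 h0, 0, fun u _ => ?_⟩
    rw [e]; simp

def SC (Q : Polynomial (Polynomial ℝ)) (N : ℕ) (u0 : ℝ) : Prop :=
  ∀ u e e', u0 ≤ u → 0 < e → 0 < e' → e * u ^ N < 1 → e' * u ^ N < 1 →
    SignType.sign (ev u e Q) = SignType.sign (ev u e' Q)

lemma sign_add_small {a b : ℝ} (h : |b| < |a|) : SignType.sign (a + b) = SignType.sign a := by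
  rcases lt_trichotomy a 0 with h1 | h1 | h1
  · rw [abs_of_neg h1] at h
    have := (abs_lt.1 h).2
    rw [sign_neg h1, sign_neg (by linarith)]
  · rw [h1, abs_zero] at h
    exact absurd h (not_lt.2 (abs_nonneg b))
  · rw [abs_of_pos h1] at h
    have := (abs_lt.1 h).1
    rw [sign_pos h1, sign_pos (by linarith)]

lemma ev_split (Q : Polynomial (Polynomial ℝ)) (u e : ℝ) :
    ev u e Q = (Q.coeff 0).eval u + e * ev u e Q.divX := by
  conv_lhs => rw [← Polynomial.divX_mul_X_add Q]
  simp [ev]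
  ring

lemma sign_const (d : ℕ) : ∀ Q : Polynomial (Polynomial ℝ), Q.natDegree ≤ d →
    ∃ N u0, 1 ≤ u0 ∧ SC Q N u0 := by
  have main : ∀ Q : Polynomial (Polynomial ℝ), Q.coeff 0 ≠ 0 → ∃ N u0, 1 ≤ u0 ∧ SC Q N u0 := by
    intro Q hQ
    obtain ⟨δ, hδ, u1, h1⟩ := low_bd hQ
    obtain ⟨c, N, hc, h2⟩ := Bd_ev Q.divX
    refine ⟨N + 1, max (max 1 u1) (c / δ + 1), (le_max_left _ _).trans (le_max_left _ _), ?_⟩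
    have key : ∀ u e, max (max 1 u1) (c / δ + 1) ≤ u → 0 < e → e * u ^ (N+1) < 1 →
        SignType.sign (ev u e Q) = SignType.sign ((Q.coeff 0).eval u) := by
      intro u e hu he hs
      have a1 : 1 ≤ u := ((le_max_left _ _).trans (le_max_left _ _)).trans hu
      have a2 : u1 ≤ u := ((le_max_right _ _).trans (le_max_left _ _)).trans hu
      have a3 : c / δ + 1 ≤ u := (le_max_right _ _).trans hu
      have a4 : c < δ * u := by
        have : c / δ < u := by linarith
        rw [div_lt_iff₀ hδ] at this; linarith
      have a5 : e ≤ 1 := by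
        have : 1 ≤ u ^ (N+1) := one_le_pow₀ a1
        nlinarith
      rw [ev_split]
      apply sign_add_small
      refine lt_of_lt_of_le ?_ (h1 u a2)
      rw [abs_mul, abs_of_pos he]
      have a6 := h2 u e a1 he a5
      have a7 : e * |ev u e Q.divX| ≤ e * (c * u ^ N) := by gcongr
      have a8 : (e * (c * u ^ N)) * u < δ * u := by
        calc (e * (c * u ^ N)) * u = c * (e * u ^ (N+1)) := by ring
          _ ≤ c * 1 := by gcongr
          _ < δ * u := by linarith
      have a9 := lt_of_mul_lt_mul_right a8 (by linarith)
      linarith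
    intro u e e' hu he he' hs hs'
    rw [key u e hu he hs, key u e' hu he' hs']
  induction d with
  | zero =>
    intro Q hQ
    by_cases h : Q.coeff 0 = 0
    · have e := Polynomial.eq_C_of_natDegree_eq_zero (Nat.le_zero.1 hQ)
      rw [h, Polynomial.C_0] at e
      exact ⟨0, 1, le_rfl, fun u e e' _ _ _ _ _ => by simp [*]⟩
    · exact main Q h
  | succ d ih =>
    intro Q hQ
    by_cases h : Q.coeff 0 = 0
    · obtain ⟨N, u0, h1, h2⟩ := ih Q.divX (by rw [Polynomial.natDegree_divX_eq_natDegree_tsub_one]; omega)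
      refine ⟨N, u0, h1, fun u e e' hu he he' hs hs' => ?_⟩
      rw [ev_split Q u e, ev_split Q u e', h, Polynomial.eval_zero, zero_add, zero_add, sign_mul, sign_mul,
        sign_pos he, sign_pos he', h2 u e e' hu he he' hs hs']
    · exact main Q h

lemma sign_const_all (M : Finset (Polynomial (Polynomial ℝ))) :
    ∃ N u0, 1 ≤ u0 ∧ 1 ≤ N ∧ ∀ Q ∈ M, SC Q N u0 := by
  classical
  induction M using Finset.induction_on with
  | empty => exact ⟨1, 1, le_rfl, le_rfl, by simp⟩
  | insert Q M _ ih =>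
    obtain ⟨N, u0, h1, hN, h2⟩ := ih
    obtain ⟨N', u0', h1', h2'⟩ := sign_const _ Q le_rfl
    have mono : ∀ u e : ℝ, 1 ≤ u → 0 < e → e * u ^ (N + N') < 1 → e * u ^ N < 1 ∧ e * u ^ N' < 1 := by
      intro u e hu he h
      constructor
      · refine lt_of_le_of_lt ?_ h
        gcongr
        omega
      · refine lt_of_le_of_lt ?_ h
        gcongr
        omega
    refine ⟨N + N', max u0 u0', h1.trans (le_max_left _ _), by omega, ?_⟩
    intro R hR u e e' hu he he' hs hs'
    have hu1 := (le_max_left _ _).trans hu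
    have hu2 := (le_max_right _ _).trans hu
    have m1 := mono u e (h1.trans hu1) he hs
    have m2 := mono u e' (h1.trans hu1) he' hs'
    rcases Finset.mem_insert.1 hR with rfl | hR
    · exact h2' u e e' hu2 he he' m1.2 m2.2
    · exact h2 R hR u e e' hu1 he he' m1.1 m2.1

noncomputable def nx (n : ℕ) : MvPolynomial (Fin n) ℝ := ∑ i, MvPolynomial.X i ^ 2

lemma nx_eval {n : ℕ} (x : Fin n → ℝ) : MvPolynomial.eval x (nx n) = ∑ i, x i ^ 2 := by
  simp [nx]

lemma nx_nonneg {n : ℕ} (x : Fin n → ℝ) : 0 ≤ MvPolynomial.eval x (nx n) := by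
  rw [nx_eval]; positivity

noncomputable def incl : ℝ →+* Polynomial (Polynomial ℝ) := Polynomial.C.comp Polynomial.C

lemma eval₂_incl {n : ℕ} (u e : ℝ) (x : Fin n → ℝ) (m : MvPolynomial (Fin n) ℝ) :
    MvPolynomial.eval₂ (ev u e) x (MvPolynomial.map incl m) = MvPolynomial.eval x m := by
  rw [MvPolynomial.eval₂_map, Subsingleton.elim ((ev u e).comp incl) (RingHom.id ℝ),
    MvPolynomial.eval₂_id]

lemma loj {n : ℕ} (S : Set (Fin n → ℝ)) (hS : IsClosed S) (M : Finset (MvPolynomial (Fin n) ℝ))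
    (hM : ∀ x x', (∀ m ∈ M, SignType.sign (MvPolynomial.eval x m) =
      SignType.sign (MvPolynomial.eval x' m)) → x ∈ S → x' ∈ S)
    (A B : MvPolynomial (Fin n) ℝ)
    (hAB : ∀ x ∈ S, MvPolynomial.eval x A = 0 → MvPolynomial.eval x B = 0) :
    ∃ (N : ℕ) (u0 : ℝ), 1 ≤ N ∧ 1 ≤ u0 ∧ ∀ x ∈ S, 0 < MvPolynomial.eval x B →
      1 ≤ (MvPolynomial.eval x A) ^ 2 *
        (u0 + MvPolynomial.eval x (nx n) + 1 / MvPolynomial.eval x B) ^ N := by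
  classical
  let K := Polynomial (Polynomial ℝ)
  let U : MvPolynomial (Fin n) K := MvPolynomial.C (Polynomial.C Polynomial.X)
  let E : MvPolynomial (Fin n) K := MvPolynomial.C Polynomial.X
  let l1 : MvPolynomial (Fin n) K := U - MvPolynomial.map incl (nx n)
  let l2 : MvPolynomial (Fin n) K := U * MvPolynomial.map incl B - 1
  let l3 : MvPolynomial (Fin n) K := E - MvPolynomial.map incl (A ^ 2)
  obtain ⟨M0, h0⟩ := elim_multi n (M.image (MvPolynomial.map incl) ∪ {l1, l2, l3})
  obtain ⟨N, u0, hu0, hN, hc⟩ := sign_const_all M0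
  have e1 : ∀ u e x, MvPolynomial.eval₂ (ev u e) x l1 = u - MvPolynomial.eval x (nx n) := by
    intro u e x
    simp only [l1, U, MvPolynomial.eval₂_sub, eval₂_incl, MvPolynomial.eval₂_C]
    simp [ev]
  have e2 : ∀ u e x, MvPolynomial.eval₂ (ev u e) x l2 = u * MvPolynomial.eval x B - 1 := by
    intro u e x
    simp only [l2, U, MvPolynomial.eval₂_sub, MvPolynomial.eval₂_mul, eval₂_incl,
      MvPolynomial.eval₂_C, MvPolynomial.eval₂_one]
    simp [ev]
  have e3 : ∀ u e x, MvPolynomial.eval₂ (ev u e) x l3 = e - (MvPolynomial.eval x A) ^ 2 := by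
    intro u e x
    simp only [l3, E, MvPolynomial.eval₂_sub, eval₂_incl, MvPolynomial.eval₂_C]
    simp [ev]
  refine ⟨N, u0, hN, hu0, fun x hx hB => ?_⟩
  by_contra hlt
  push Not at hlt
  set u := u0 + MvPolynomial.eval x (nx n) + 1 / MvPolynomial.eval x B with hu
  have hnx := nx_nonneg x
  have hBi : 0 < 1 / MvPolynomial.eval x B := by positivity
  have hA : 0 < (MvPolynomial.eval x A) ^ 2 := by
    have : MvPolynomial.eval x A ≠ 0 := fun e => by rw [hAB x hx e] at hB; exact lt_irrefl _ hB
    positivity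
  have huu : u0 ≤ u := by linarith
  have hu1 : 1 ≤ u := by linarith
  have huB : 1 ≤ u * MvPolynomial.eval x B := by
    have : 1 / MvPolynomial.eval x B ≤ u := by linarith
    rwa [div_le_iff₀ hB] at this
  let T : Set (Fin n → ℝ) := S ∩ ({x | MvPolynomial.eval x (nx n) ≤ u} ∩
    {x | 1 ≤ u * MvPolynomial.eval x B})
  have hxT : x ∈ T := ⟨hx, by show MvPolynomial.eval x (nx n) ≤ u; linarith, huB⟩
  have hTc : IsClosed T := hS.inter ((isClosed_le (MvPolynomial.continuous_eval _) continuous_const).inter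
    (isClosed_le continuous_const (continuous_const.mul (MvPolynomial.continuous_eval _))))
  have hTk : IsCompact T := by
    refine (isCompact_univ_pi (fun _ : Fin n => isCompact_Icc (a := -u) (b := u))).of_isClosed_subset hTc ?_
    intro z hz i _
    have h1 : MvPolynomial.eval z (nx n) ≤ u := hz.2.1
    rw [nx_eval] at h1
    have h2 : z i ^ 2 ≤ ∑ i, z i ^ 2 := Finset.single_le_sum (f := fun i => z i ^ 2)
      (fun i _ => sq_nonneg (z i)) (Finset.mem_univ i)
    constructor <;> nlinarith
  obtain ⟨z, hzT, hz⟩ := hTk.exists_isMinOn ⟨x, hxT⟩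
    (f := fun x => (MvPolynomial.eval x A) ^ 2) ((MvPolynomial.continuous_eval A).pow 2).continuousOn
  have hTA : ∀ y ∈ T, MvPolynomial.eval y A ≠ 0 := by
    intro y hy e
    have h1 := hAB y hy.1 e
    have h2 : 1 ≤ u * MvPolynomial.eval y B := hy.2.2
    rw [h1] at h2
    linarith
  have hzp : 0 < (MvPolynomial.eval z A) ^ 2 := by
    have := hTA z hzT
    positivity
  have hzx : (MvPolynomial.eval z A) ^ 2 ≤ (MvPolynomial.eval x A) ^ 2 := hz hxT
  have hsm : (MvPolynomial.eval z A) ^ 2 / 2 * u ^ N < 1 := by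
    refine lt_of_le_of_lt ?_ hlt
    gcongr
    linarith
  obtain ⟨x', hx'⟩ := h0 (ev u ((MvPolynomial.eval x A) ^ 2)) (ev u ((MvPolynomial.eval z A) ^ 2 / 2))
    (fun m hm => hc m hm u _ _ huu hA (by linarith) hlt hsm) x
  have f1 := hx' l1 (by simp)
  have f2 := hx' l2 (by simp)
  have f3 := hx' l3 (by simp)
  rw [e1, e1] at f1
  rw [e2, e2] at f2
  rw [e3, e3] at f3
  have hx'T : x' ∈ T := by
    refine ⟨hM x x' (fun m hm => ?_) hx, ?_, ?_⟩
    · have := hx' (MvPolynomial.map incl m) (Finset.mem_union_left _ (Finset.mem_image_of_mem _ hm))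
      rwa [eval₂_incl, eval₂_incl] at this
    · show MvPolynomial.eval x' (nx n) ≤ u
      by_contra h
      have := (sign_neg_iff' f1).2 (by linarith)
      linarith
    · show 1 ≤ u * MvPolynomial.eval x' B
      by_contra h
      have := (sign_neg_iff' f2).2 (by linarith)
      linarith
  have g1 : (MvPolynomial.eval x' A) ^ 2 ≤ (MvPolynomial.eval z A) ^ 2 / 2 := by
    by_contra h
    have := (sign_neg_iff' f3).2 (by linarith)
    linarith
  have g2 : (MvPolynomial.eval z A) ^ 2 ≤ (MvPolynomial.eval x' A) ^ 2 := hz hx'T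
  linarith

lemma sign_of {a b : ℝ} (h0 : a = 0 → b = 0) (h1 : 0 < a → 0 < b) (h2 : a < 0 → b < 0) :
    SignType.sign a = SignType.sign b := by
  rcases lt_trichotomy a 0 with h | h | h
  · rw [sign_neg h, sign_neg (h2 h)]
  · rw [h, h0 h]
  · rw [sign_pos h, sign_pos (h1 h)]

lemma glue {n : ℕ} (g : (Fin n → ℝ) → ℝ) (hg : Continuous g) (w a b r h : MvPolynomial (Fin n) ℝ)
    (hh : ∀ x, 0 ≤ MvPolynomial.eval x h)
    (hz : ∀ x, MvPolynomial.eval x w = 0 → (MvPolynomial.eval x h = 0 ↔ g x = 0))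
    (hab : ∀ x, MvPolynomial.eval x w = 0 → g x * MvPolynomial.eval x b = MvPolynomial.eval x a)
    (hr : ∀ x, MvPolynomial.eval x w = 0 → MvPolynomial.eval x b = 0 →
      SignType.sign (g x) = SignType.sign (MvPolynomial.eval x r)) :
    ∃ p : MvPolynomial (Fin n) ℝ, ∀ x, MvPolynomial.eval x w = 0 →
      SignType.sign (g x) = SignType.sign (MvPolynomial.eval x p) := by
  classical
  let S : Set (Fin n → ℝ) := {x | MvPolynomial.eval x w = 0} ∩ {x | g x * MvPolynomial.eval x r ≤ 0}
  have hS : IsClosed S := (isClosed_eq (MvPolynomial.continuous_eval _) continuous_const).inter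
    (isClosed_le (hg.mul (MvPolynomial.continuous_eval _)) continuous_const)
  have hsg : ∀ x, MvPolynomial.eval x w = 0 → MvPolynomial.eval x b ≠ 0 →
      SignType.sign (g x) = SignType.sign (MvPolynomial.eval x a) * SignType.sign (MvPolynomial.eval x b) := by
    intro x hx hb
    rw [← hab x hx, ← sign_mul, mul_assoc, sign_mul, sign_pos (mul_self_pos.2 hb), mul_one]
  obtain ⟨N, u0, hN, hu0, hl⟩ := loj S hS {w, a, b, r} (by
    intro x x' hm hx
    simp only [Finset.mem_insert, Finset.mem_singleton, forall_eq_or_imp, forall_eq] at hm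
    obtain ⟨m1, m2, m3, m4⟩ := hm
    have hw : MvPolynomial.eval x w = 0 := hx.1
    have hw' : MvPolynomial.eval x' w = 0 := (sign_zero_iff' m1).1 hw
    have : SignType.sign (g x) = SignType.sign (g x') := by
      by_cases hb : MvPolynomial.eval x b = 0
      · rw [hr x hw hb, hr x' hw' ((sign_zero_iff' m3).1 hb), m4]
      · rw [hsg x hw hb, hsg x' hw' (fun e => hb ((sign_zero_iff' m3).2 e)), m2, m3]
    refine ⟨hw', ?_⟩
    show g x' * MvPolynomial.eval x' r ≤ 0
    by_contra hlt
    have h1 : SignType.sign (g x * MvPolynomial.eval x r) = SignType.sign (g x' * MvPolynomial.eval x' r) := by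
      rw [sign_mul, sign_mul, this, m4]
    have h2 := (sign_pos_iff' h1).2 (not_le.1 hlt)
    have h3 : g x * MvPolynomial.eval x r ≤ 0 := hx.2
    linarith) (a * b) h (by
    intro x hx h0
    have hw : MvPolynomial.eval x w = 0 := hx.1
    have h3 : g x * MvPolynomial.eval x r ≤ 0 := hx.2
    rw [hz x hw]
    by_cases hb : MvPolynomial.eval x b = 0
    · have s := hr x hw hb
      rcases lt_trichotomy (g x) 0 with h | h | h
      · have := (sign_neg_iff' s).1 h; nlinarith
      · exact h
      · have := (sign_pos_iff' s).1 h; nlinarith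
    · rw [map_mul] at h0
      have ha := (mul_eq_zero.1 h0).resolve_right hb
      have := hab x hw
      rw [ha] at this
      exact (mul_eq_zero.1 this).resolve_right hb)
  refine ⟨r * h ^ N + a * b * ((h * (MvPolynomial.C u0 + nx n) + 1) ^ N *
    ((1 + (a * b) ^ 2) * (1 + r ^ 2))), fun x hw => ?_⟩
  have key : g x * MvPolynomial.eval x r ≤ 0 → 0 < MvPolynomial.eval x h →
      (MvPolynomial.eval x h) ^ N ≤ (MvPolynomial.eval x (a * b)) ^ 2 *
      (MvPolynomial.eval x h * (u0 + MvPolynomial.eval x (nx n)) + 1) ^ N := by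
    intro h1 h2
    have h3 := hl x ⟨hw, h1⟩ h2
    have h4 : MvPolynomial.eval x h * (u0 + MvPolynomial.eval x (nx n)) + 1 =
      (u0 + MvPolynomial.eval x (nx n) + 1 / MvPolynomial.eval x h) * MvPolynomial.eval x h := by
      field_simp
    rw [h4, mul_pow, ← mul_assoc]
    have := mul_le_mul_of_nonneg_right h3 (pow_nonneg h2.le N)
    linarith
  have hAe : MvPolynomial.eval x (a * b) = g x * (MvPolynomial.eval x b) ^ 2 := by
    rw [map_mul, ← hab x hw]; ring
  have hev : MvPolynomial.eval x (r * h ^ N + a * b * ((h * (MvPolynomial.C u0 + nx n) + 1) ^ N *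
    ((1 + (a * b) ^ 2) * (1 + r ^ 2)))) = MvPolynomial.eval x r * MvPolynomial.eval x h ^ N +
      MvPolynomial.eval x (a * b) * ((MvPolynomial.eval x h * (u0 + MvPolynomial.eval x (nx n)) + 1) ^ N *
    ((1 + (MvPolynomial.eval x (a * b)) ^ 2) * (1 + MvPolynomial.eval x r ^ 2))) := by
    simp only [map_add, map_mul, map_pow, map_one, MvPolynomial.eval_C]
  rw [hev]
  have hv1 : 0 < MvPolynomial.eval x h * (u0 + MvPolynomial.eval x (nx n)) + 1 := by
    have := nx_nonneg x
    have := hh x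
    positivity
  set A := MvPolynomial.eval x (a * b)
  set R := MvPolynomial.eval x r
  set H := MvPolynomial.eval x h
  set W := (H * (u0 + MvPolynomial.eval x (nx n)) + 1) ^ N with hW
  have hWp : 0 < W := pow_pos hv1 N
  have est : A ≠ 0 → |R| * |A| < (1 + A ^ 2) * (1 + R ^ 2) := by
    intro _
    have h1 := sq_abs A
    have h2 := sq_abs R
    rw [← h1, ← h2]
    nlinarith [sq_nonneg (|R| - |A|), sq_nonneg (|R| * |A|)]
  apply sign_of
  · intro h0
    have hH : H = 0 := (hz x hw).2 h0
    rw [hAe, h0, hH, zero_pow (by omega)]; simp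
  · intro h0
    have hH : 0 < H := lt_of_le_of_ne (hh x) (fun e => by have := (hz x hw).1 e.symm; linarith)
    have hA : 0 ≤ A := by rw [hAe]; positivity
    have hHN : 0 < H ^ N := pow_pos hH N
    rcases lt_or_ge 0 R with hR | hR
    · have : 0 ≤ A * (W * ((1 + A ^ 2) * (1 + R ^ 2))) := by positivity
      have : 0 < R * H ^ N := by positivity
      linarith
    · have k := key (by nlinarith) hH
      have hA0 : A ≠ 0 := fun e => by rw [e] at k; simp at k; linarith
      have hAp : 0 < A := lt_of_le_of_ne hA (Ne.symm hA0)
      have e1 := est hA0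
      rw [abs_of_nonpos hR, abs_of_pos hAp] at e1
      have e2 : (-R) * H ^ N ≤ (-R) * (A ^ 2 * W) := mul_le_mul_of_nonneg_left k (by linarith)
      have e3 : (A * W) * (-R * A) < (A * W) * ((1 + A ^ 2) * (1 + R ^ 2)) :=
        mul_lt_mul_of_pos_left e1 (by positivity)
      nlinarith
  · intro h0
    have hH : 0 < H := lt_of_le_of_ne (hh x) (fun e => by have := (hz x hw).1 e.symm; linarith)
    have hA : A ≤ 0 := by rw [hAe]; nlinarith [sq_nonneg (MvPolynomial.eval x b)]
    have hHN : 0 < H ^ N := pow_pos hH N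
    rcases lt_or_ge R 0 with hR | hR
    · have : 0 ≤ (-A) * (W * ((1 + A ^ 2) * (1 + R ^ 2))) := by
        have : 0 ≤ -A := by linarith
        positivity
      have : 0 < (-R) * H ^ N := mul_pos (by linarith) hHN
      linarith
    · have k := key (by nlinarith) hH
      have hA0 : A ≠ 0 := fun e => by rw [e] at k; simp at k; linarith
      have hAp : A < 0 := lt_of_le_of_ne hA hA0
      have e1 := est hA0
      rw [abs_of_nonneg hR, abs_of_neg hAp] at e1
      have e2 : R * H ^ N ≤ R * (A ^ 2 * W) := mul_le_mul_of_nonneg_left k hR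
      have e3 : ((-A) * W) * (R * (-A)) < ((-A) * W) * ((1 + A ^ 2) * (1 + R ^ 2)) :=
        mul_lt_mul_of_pos_left e1 (mul_pos (by linarith) hWp)
      nlinarith

lemma line_coeff (γ : ℝ → ℝ) (hγ : Continuous γ) (k : ℕ) : ∀ α β : Polynomial ℝ,
    (∀ t, γ t * β.eval t = α.eval t) → (∀ j < k, β.coeff j = 0) → γ 0 * β.coeff k = α.coeff k := by
  induction k with
  | zero =>
    intro α β h _
    have := h 0
    rwa [← Polynomial.coeff_zero_eq_eval_zero, ← Polynomial.coeff_zero_eq_eval_zero] at this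
  | succ k ih =>
    intro α β h hj
    have b0 : β.coeff 0 = 0 := hj 0 (by omega)
    have a0 : α.coeff 0 = 0 := by
      have := h 0
      rw [← Polynomial.coeff_zero_eq_eval_zero, ← Polynomial.coeff_zero_eq_eval_zero, b0] at this
      linarith
    have eb := Polynomial.divX_mul_X_add β
    have ea := Polynomial.divX_mul_X_add α
    rw [b0, Polynomial.C_0, add_zero] at eb
    rw [a0, Polynomial.C_0, add_zero] at ea
    have h1 : ∀ t, t ≠ 0 → γ t * β.divX.eval t = α.divX.eval t := by
      intro t ht
      have := h t
      rw [← eb, ← ea, Polynomial.eval_mul, Polynomial.eval_mul, Polynomial.eval_X, ← mul_assoc] at this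
      exact mul_right_cancel₀ ht this
    have h2 : (fun t => γ t * β.divX.eval t) = fun t => α.divX.eval t := by
      refine Continuous.ext_on (s := {0}ᶜ) (dense_compl_singleton (0:ℝ)) (hγ.mul β.divX.continuous)
        α.divX.continuous ?_
      intro t ht
      exact h1 t ht
    have := ih α.divX β.divX (fun t => congrFun h2 t) (fun j hj' => by
      rw [Polynomial.coeff_divX]; exact hj _ (by omega))
    rwa [Polynomial.coeff_divX, Polynomial.coeff_divX] at this

noncomputable def shift {n : ℕ} (v : Fin n → ℝ) (q : MvPolynomial (Fin n) ℝ) :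
    Polynomial (MvPolynomial (Fin n) ℝ) :=
  MvPolynomial.aeval (fun i => Polynomial.C (MvPolynomial.X i) +
    Polynomial.C (MvPolynomial.C (v i)) * Polynomial.X) q

lemma shift_eval {n : ℕ} (v y : Fin n → ℝ) (t : ℝ) (q : MvPolynomial (Fin n) ℝ) :
    ((shift v q).map (MvPolynomial.eval y)).eval t = MvPolynomial.eval (fun i => y i + v i * t) q := by
  unfold shift
  induction q using MvPolynomial.induction_on with
  | C r => simp [Polynomial.algebraMap_apply]
  | add p q hp hq => simp only [map_add, Polynomial.map_add, Polynomial.eval_add, hp, hq]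
  | mul_X p i hp => simp only [map_mul, Polynomial.map_mul, Polynomial.eval_mul, hp]; simp

lemma good {n : ℕ} (g : (Fin n → ℝ) → ℝ) (hg : Continuous g) (p q h : MvPolynomial (Fin n) ℝ)
    (x0 : Fin n → ℝ) (hx0 : MvPolynomial.eval x0 q ≠ 0)
    (hpq : ∀ x, g x * MvPolynomial.eval x q = MvPolynomial.eval x p)
    (hh : ∀ x, 0 ≤ MvPolynomial.eval x h) (I : Ideal (MvPolynomial (Fin n) ℝ)) :
    ∀ w : MvPolynomial (Fin n) ℝ, vanishingIdealOf {x | MvPolynomial.eval x w = 0} = I →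
    (∀ x, MvPolynomial.eval x w = 0 → (MvPolynomial.eval x h = 0 ↔ g x = 0)) →
    ∃ p : MvPolynomial (Fin n) ℝ, ∀ x, MvPolynomial.eval x w = 0 →
      SignType.sign (g x) = SignType.sign (MvPolynomial.eval x p) := by
  induction I using WellFoundedGT.induction with
  | ind I ih =>
  intro w hI hz
  by_cases hne : ∃ y, MvPolynomial.eval y w = 0
  swap
  · exact ⟨0, fun x hx => absurd ⟨x, hx⟩ hne⟩
  obtain ⟨y0, hy0⟩ := hne
  classical
  let v : Fin n → ℝ := fun i => x0 i - y0 i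
  have hex : ∃ k, ∃ y, MvPolynomial.eval y w = 0 ∧ MvPolynomial.eval y ((shift v q).coeff k) ≠ 0 := by
    by_contra hc
    push Not at hc
    apply hx0
    have h1 := shift_eval v y0 1 q
    have h2 : (shift v q).map (MvPolynomial.eval y0) = 0 := by
      ext k
      rw [Polynomial.coeff_map]
      simpa using hc k y0 hy0
    rw [h2] at h1
    have h3 : (fun i => y0 i + v i * 1) = x0 := by funext i; simp [v]
    rw [h3] at h1
    simpa using h1.symm
  let k := Nat.find hex
  obtain ⟨y1, hy1, hy1b⟩ := Nat.find_spec hex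
  have hmin : ∀ j < k, ∀ y, MvPolynomial.eval y w = 0 → MvPolynomial.eval y ((shift v q).coeff j) = 0 := by
    intro j hj y hy
    by_contra hc
    exact Nat.find_min hex hj ⟨y, hy, hc⟩
  let b := (shift v q).coeff k
  let a := (shift v p).coeff k
  have hab : ∀ x, MvPolynomial.eval x w = 0 → g x * MvPolynomial.eval x b = MvPolynomial.eval x a := by
    intro x hx
    have := line_coeff (fun t => g (fun i => x i + v i * t)) (hg.comp (by fun_prop)) k
      ((shift v p).map (MvPolynomial.eval x)) ((shift v q).map (MvPolynomial.eval x))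
      (fun t => by rw [shift_eval, shift_eval]; exact hpq _)
      (fun j hj => by rw [Polynomial.coeff_map]; exact hmin j hj x hx)
    simpa [Polynomial.coeff_map] using this
  have hw2 : ∀ x, MvPolynomial.eval x (w ^ 2 + b ^ 2) = 0 ↔
      MvPolynomial.eval x w = 0 ∧ MvPolynomial.eval x b = 0 := by
    intro x
    simp only [map_add, map_pow]
    constructor
    · intro e
      constructor <;> nlinarith [sq_nonneg (MvPolynomial.eval x w), sq_nonneg (MvPolynomial.eval x b)]
    · rintro ⟨e1, e2⟩
      rw [e1, e2]; ring
  have hlt : I < vanishingIdealOf {x | MvPolynomial.eval x (w ^ 2 + b ^ 2) = 0} := by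
    rw [← hI]
    refine lt_of_le_of_ne ?_ ?_
    · intro s hs x hx
      exact hs x ((hw2 x).1 hx).1
    · intro e
      have : b ∈ vanishingIdealOf {x | MvPolynomial.eval x (w ^ 2 + b ^ 2) = 0} :=
        fun x hx => ((hw2 x).1 hx).2
      rw [← e] at this
      exact hy1b (this y1 hy1)
  obtain ⟨r, hr⟩ := ih _ hlt (w ^ 2 + b ^ 2) rfl (fun x hx => hz x ((hw2 x).1 hx).1)
  exact glue g hg w a b r h hh hz hab (fun x h1 h2 => hr x ((hw2 x).2 ⟨h1, h2⟩))

lemma sumsq {n k : ℕ} (p : Fin k → MvPolynomial (Fin n) ℝ) (x : Fin n → ℝ) :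
    0 ≤ MvPolynomial.eval x (∑ i, p i ^ 2) ∧
    (MvPolynomial.eval x (∑ i, p i ^ 2) = 0 ↔ ∀ i, MvPolynomial.eval x (p i) = 0) := by
  simp only [map_sum, map_pow]
  refine ⟨by positivity, ?_⟩
  rw [Finset.sum_eq_zero_iff_of_nonneg (fun i _ => sq_nonneg _)]
  simp

lemma realSign_iff {a b : ℝ} : Real.sign a = Real.sign b ↔ SignType.sign a = SignType.sign b := by
  rcases lt_trichotomy a 0 with h | h | h <;> rcases lt_trichotomy b 0 with h' | h' | h' <;>
    simp [h, h', Real.sign_of_neg, Real.sign_of_pos, sign_neg, sign_pos] <;> norm_num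

/-- for a nonzero regulous function `f` on `X`, `Z(f)` is Zariski closed iff
the sign of `f` is the sign of a polynomial function on `X`. -/
theorem zariski_closed_zero_set_iff_sign_poly {n : ℕ} (X : Set (Fin n → ℝ))
    (hX : IsRealAlgebraicSet X) (f : (Fin n → ℝ) → ℝ) (hf : IsRegulousOn X f)
    (hne : ∃ x ∈ X, f x ≠ 0) :
    IsZariskiClosedIn X {x ∈ X | f x = 0} ↔
      ∃ p : MvPolynomial (Fin n) ℝ,
        ∀ x ∈ X, Real.sign (f x) = Real.sign (MvPolynomial.eval x p) := by
  obtain ⟨k, P, hP⟩ := hX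
  have hXw : ∀ x, x ∈ X ↔ MvPolynomial.eval x (∑ i, P i ^ 2) = 0 := by
    intro x
    rw [(sumsq P x).2, hP]; rfl
  constructor
  · rintro ⟨⟨m, H, hH⟩, _⟩
    obtain ⟨g, ⟨hg, U, ⟨_, j, s, hs⟩, ⟨x0, hx0⟩, p, q, hq, hpq⟩, hfg⟩ := hf
    have hmem : ∀ x, (∃ i, MvPolynomial.eval x (s i) ≠ 0) → x ∈ U := by
      rintro x ⟨i, hi⟩
      by_contra hx
      have : x ∈ Set.univ \ U := ⟨trivial, hx⟩
      rw [hs] at this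
      exact hi (this i)
    have hx0' : ∃ i, MvPolynomial.eval x0 (s i) ≠ 0 := by
      by_contra hc
      push Not at hc
      have : x0 ∈ Set.univ \ U := by rw [hs]; exact hc
      exact this.2 hx0
    obtain ⟨i, hi⟩ := hx0'
    obtain ⟨r, hr⟩ := good g hg (s i * p) (s i * q) (∑ i, H i ^ 2) x0
      (by rw [map_mul]; exact mul_ne_zero hi (hq x0 hx0))
      (by
        intro x
        rw [map_mul, map_mul]
        by_cases h0 : MvPolynomial.eval x (s i) = 0
        · rw [h0]; ring
        · have hxU := hmem x ⟨i, h0⟩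
          have := hq x hxU
          rw [hpq x hxU]
          field_simp)
      (fun x => (sumsq H x).1) _ (∑ i, P i ^ 2) rfl (by
        intro x hx
        have hxX := (hXw x).2 hx
        rw [(sumsq H x).2, ← hfg x hxX]
        have : x ∈ {x ∈ X | f x = 0} ↔ ∀ i, MvPolynomial.eval x (H i) = 0 := by
          rw [hH]; rfl
        rw [← this]
        exact ⟨fun h => h.2, fun h => ⟨hxX, h⟩⟩)
    refine ⟨r, fun x hx => ?_⟩
    rw [realSign_iff, hfg x hx]
    exact hr x ((hXw x).1 hx)
  · rintro ⟨p, hp⟩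
    refine ⟨⟨1, fun _ => (∑ i, P i ^ 2) ^ 2 + p ^ 2, ?_⟩, fun x hx => hx.1⟩
    ext x
    have e : (∀ _ : Fin 1, MvPolynomial.eval x ((∑ i, P i ^ 2) ^ 2 + p ^ 2) = 0) ↔
        (MvPolynomial.eval x (∑ i, P i ^ 2) = 0 ∧ MvPolynomial.eval x p = 0) := by
      rw [forall_const, map_add, map_pow, map_pow]
      constructor
      · intro e
        constructor <;> nlinarith [sq_nonneg (MvPolynomial.eval x (∑ i, P i ^ 2)),
          sq_nonneg (MvPolynomial.eval x p)]
      · rintro ⟨e1, e2⟩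
        rw [e1, e2]; ring
    refine Iff.trans ?_ e.symm
    rw [← hXw]
    exact ⟨fun h => ⟨h.1, (sign_zero_iff' (realSign_iff.1 (hp x h.1))).1 h.2⟩,
      fun h => ⟨h.1, (sign_zero_iff' (realSign_iff.1 (hp x h.1))).2 h.2⟩⟩
end

section
/- Let X ⊆ ℝⁿ be a real algebraic set and let f be a regulous function on X whose polar locus pol(f) has dimension at most 1. Then the sign of f is a sum of at most 3 signs of polynomial functions on X: there exist polynomial functions p₁, p₂, p₃ on X such that sign(f)(x) = sign(p₁)(x) + sign(p₂)(x) + sign(p₃)(x) for all x ∈ X. -/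
open MvPolynomial Set

namespace SR

/-- multiplier ideal -/
def multIdeal {n : ℕ} (Z : Set (Fin n → ℝ)) (f : (Fin n → ℝ) → ℝ) :
    Ideal (MvPolynomial (Fin n) ℝ) where
  carrier := {Q | ∃ P : MvPolynomial (Fin n) ℝ, ∀ x ∈ Z, f x * eval x Q = eval x P}
  add_mem' := by
    rintro a b ⟨P, hP⟩ ⟨P', hP'⟩
    exact ⟨P + P', fun x hx => by rw [map_add, map_add, mul_add, hP x hx, hP' x hx]⟩
  zero_mem' := ⟨0, fun x hx => by simp⟩
  smul_mem' := by
    rintro c a ⟨P, hP⟩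
    exact ⟨c * P, fun x hx => by rw [smul_eq_mul, map_mul, map_mul, ← hP x hx]; ring⟩

theorem exists_sq {n : ℕ} (J : Ideal (MvPolynomial (Fin n) ℝ)) :
    ∃ Q ∈ J, ∀ x, eval x Q = 0 → ∀ R ∈ J, eval x R = 0 := by
  obtain ⟨S, hS⟩ := (isNoetherianRing_iff_ideal_fg _).1 inferInstance J
  refine ⟨∑ r ∈ S, r * r, J.sum_mem fun r hr => J.mul_mem_left _ ?_, ?_⟩
  · rw [← hS]; exact Ideal.subset_span hr
  · intro x hx R hR
    have h1 : ∀ r ∈ S, eval x r = 0 := by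
      rw [map_sum, Finset.sum_eq_zero_iff_of_nonneg] at hx
      · intro r hr
        have := hx r hr
        simpa using this
      · intro r hr
        rw [map_mul]; exact mul_self_nonneg _
    have h2 : J ≤ RingHom.ker (eval x : MvPolynomial (Fin n) ℝ →+* ℝ) := by
      rw [← hS, Ideal.span_le]
      intro r hr
      exact h1 r hr
    exact h2 hR

theorem exists_univ {n : ℕ} (K : Ideal (MvPolynomial (Fin n) ℝ))
    (hK : ∀ P : Ideal (MvPolynomial (Fin n) ℝ), P.IsPrime → K ≤ P → P.IsMaximal) (i : Fin n) :
    ∃ c : Polynomial ℝ, c ≠ 0 ∧ Polynomial.aeval (X i : MvPolynomial (Fin n) ℝ) c ∈ K := by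
  have h0 : Ring.KrullDimLE 0 (MvPolynomial (Fin n) ℝ ⧸ K) :=
    Ideal.krullDimLE_zero_quotient_iff_forall_minimalPrimes_isMaximal.2
      fun J hJ => hK J hJ.1.1 hJ.1.2
  have h1 : Module.Finite ℝ (MvPolynomial (Fin n) ℝ ⧸ K) :=
    (Module.finite_iff_krullDimLE_zero _ _).2 h0
  obtain ⟨c, hc, hc'⟩ := Algebra.IsIntegral.isIntegral (R := ℝ) (Ideal.Quotient.mk K (X i))
  refine ⟨c, hc.ne_zero, ?_⟩
  rw [← Ideal.Quotient.eq_zero_iff_mem]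
  have := Polynomial.aeval_algHom_apply (Ideal.Quotient.mkₐ ℝ K) (X i) c
  rw [← Ideal.Quotient.mkₐ_eq_mk ℝ K, ← this]
  exact hc'

theorem exists_annih {n : ℕ} (Z : Set (Fin n → ℝ)) (hd : algDim Z ≤ (1 : WithBot ℕ∞))
    (P : Ideal (MvPolynomial (Fin n) ℝ)) (hP : P.IsPrime) (hle : vanishingIdealOf Z ≤ P)
    (hm : ¬ P.IsMaximal) : ∃ s ∉ P, ∀ y ∈ P, s * y ∈ vanishingIdealOf Z := by
  classical
  set I := vanishingIdealOf Z with hI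
  have hrad : I.IsRadical := by
    intro a ⟨k, hk⟩ x hx
    have : eval x (a ^ k) = 0 := hk x hx
    rw [map_pow] at this
    exact eq_zero_of_pow_eq_zero this
  have h1 : Ring.KrullDimLE 1 (MvPolynomial (Fin n) ℝ ⧸ I) := Ring.krullDimLE_iff.2 hd
  have hsurj := Ideal.Quotient.mk_surjective (I := I)
  have hker : RingHom.ker (Ideal.Quotient.mk I) ≤ P := by rwa [Ideal.mk_ker]
  have hcm : (P.map (Ideal.Quotient.mk I)).comap (Ideal.Quotient.mk I) = P := by
    rw [Ideal.comap_map_of_surjective _ hsurj, ← RingHom.ker_eq_comap_bot]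
    exact sup_eq_left.2 hker
  have hmin : P ∈ I.minimalPrimes := by
    have hpr : (P.map (Ideal.Quotient.mk I)).IsPrime := Ideal.map_isPrime_of_surjective hsurj hker
    rcases Ring.krullDimLE_one_iff.1 h1 _ hpr with h | h
    · rw [Ideal.minimalPrimes_eq_comap]
      exact ⟨_, h, hcm⟩
    · exfalso
      apply hm
      rw [← hcm]
      exact Ideal.comap_isMaximal_of_surjective _ hsurj
  have hfin := Ideal.finite_minimalPrimes_of_isNoetherianRing (MvPolynomial (Fin n) ℝ) I
  have hnot : ¬ ((hfin.toFinset.erase P).inf id ≤ P) := by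
    rw [hP.inf_le']
    rintro ⟨Q, hQ, hQP⟩
    rw [Finset.mem_erase, Set.Finite.mem_toFinset] at hQ
    exact hQ.1 (le_antisymm hQP (hmin.2 hQ.2.1 hQP))
  obtain ⟨s, hs, hsP⟩ := SetLike.not_le_iff_exists.1 hnot
  refine ⟨s, hsP, fun y hy => ?_⟩
  rw [← hrad.radical, ← Ideal.sInf_minimalPrimes, Ideal.mem_sInf]
  intro Q hQ
  by_cases hQP : Q = P
  · subst hQP; exact Q.mul_mem_left _ hy
  · apply Q.mul_mem_right
    exact (Finset.inf_le (f := id) (by simp [hQP, hQ]) : _ ≤ Q) hs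

theorem lim_coeff (φ : ℝ → ℝ) (hφ : ContinuousAt φ 0) (k : ℕ) : ∀ (a b : Polynomial ℝ),
    (∀ t, φ t * a.eval t = b.eval t) → (∀ j < k, a.coeff j = 0) →
    φ 0 * a.coeff k = b.coeff k := by
  -- weaker version: for t ≠ 0
  have key : ∀ a b : Polynomial ℝ, (∀ t ≠ 0, φ t * a.eval t = b.eval t) →
      φ 0 * a.eval 0 = b.eval 0 := by
    intro a b h
    have h1 : Filter.Tendsto (fun t => φ t * a.eval t) (nhdsWithin 0 {0}ᶜ)
        (nhds (φ 0 * a.eval 0)) :=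
      ((hφ.mul a.continuous.continuousAt).tendsto).mono_left nhdsWithin_le_nhds
    have h2 : Filter.Tendsto (fun t => b.eval t) (nhdsWithin 0 {0}ᶜ) (nhds (b.eval 0)) :=
      (b.continuous.continuousAt.tendsto).mono_left nhdsWithin_le_nhds
    refine tendsto_nhds_unique (h1.congr' ?_) h2
    filter_upwards [self_mem_nhdsWithin] with t ht
    exact h t ht
  have main : ∀ (k : ℕ) (a b : Polynomial ℝ),
    (∀ t ≠ 0, φ t * a.eval t = b.eval t) → (∀ j < k, a.coeff j = 0) →
    φ 0 * a.coeff k = b.coeff k := by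
    intro k
    induction k with
    | zero =>
      intro a b h _
      rw [Polynomial.coeff_zero_eq_eval_zero, Polynomial.coeff_zero_eq_eval_zero]
      exact key a b h
    | succ k ih =>
      intro a b h h0
      have ha0 := h0 0 (Nat.succ_pos _)
      have hb0 : b.coeff 0 = 0 := by
        have := key a b h
        rw [← Polynomial.coeff_zero_eq_eval_zero, ← Polynomial.coeff_zero_eq_eval_zero, ha0] at this
        rw [← this, mul_zero]
      have ha := Polynomial.X_mul_divX_add a
      have hb := Polynomial.X_mul_divX_add b
      rw [ha0, Polynomial.C_0, add_zero] at ha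
      rw [hb0, Polynomial.C_0, add_zero] at hb
      rw [← Polynomial.coeff_divX, ← Polynomial.coeff_divX]
      apply ih
      · intro t ht
        have := h t ht
        rw [← ha, ← hb, Polynomial.eval_mul, Polynomial.eval_mul, Polynomial.eval_X] at this
        apply mul_left_cancel₀ ht
        linarith
      · intro j hj
        rw [Polynomial.coeff_divX]
        exact h0 _ (by omega)
  exact fun a b h h0 => main k a b (fun t _ => h t) h0

noncomputable def lineExp {n : ℕ} (v : Fin n → ℝ) :
    MvPolynomial (Fin n) ℝ →ₐ[ℝ] Polynomial (MvPolynomial (Fin n) ℝ) :=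
  aeval fun i => Polynomial.C (X i) + Polynomial.C (C (v i)) * Polynomial.X

theorem lineExp_eval {n : ℕ} (v x : Fin n → ℝ) (t : ℝ) (q : MvPolynomial (Fin n) ℝ) :
    ((lineExp v q).map (eval x)).eval t = eval (x + t • v) q := by
  induction q using MvPolynomial.induction_on with
  | C a =>
    have : lineExp v (C a) = Polynomial.C (C a) := by
      rw [lineExp, aeval_C]; rfl
    rw [this]; simp
  | add p q hp hq => simp [hp, hq]
  | mul_X p i hp =>
    rw [map_mul, Polynomial.map_mul, Polynomial.eval_mul, hp, map_mul]
    simp [lineExp]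
    left; ring

theorem isMaximal_of_multIdeal_le {n : ℕ} (Z : Set (Fin n → ℝ)) (g : (Fin n → ℝ) → ℝ)
    (hg : Continuous g) (p q : MvPolynomial (Fin n) ℝ) (hq : q ≠ 0)
    (hgq : ∀ x, g x * eval x q = eval x p)
    (hd : algDim Z ≤ (1 : WithBot ℕ∞)) (P : Ideal (MvPolynomial (Fin n) ℝ)) (hP : P.IsPrime)
    (hle : multIdeal Z g ≤ P) : P.IsMaximal := by
  classical
  by_contra hm
  have hIP : vanishingIdealOf Z ≤ P := by
    refine le_trans ?_ hle
    intro a ha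
    exact ⟨0, fun x hx => by rw [show eval x a = 0 from ha x hx]; simp⟩
  obtain ⟨s, hs, hsP⟩ := exists_annih Z hd P hP hIP hm
  have hV : ∀ x ∈ Z, eval x s ≠ 0 → ∀ y ∈ P, eval x y = 0 := by
    intro x hx hsx y hy
    have : eval x (s * y) = 0 := hsP y hy x hx
    rw [map_mul] at this
    exact (mul_eq_zero.1 this).resolve_left hsx
  obtain ⟨x0, hx0, hsx0⟩ : ∃ x ∈ Z, eval x s ≠ 0 := by
    by_contra hcon
    push Not at hcon
    exact hs (hIP hcon)
  obtain ⟨y, hy⟩ : ∃ y, eval y q ≠ 0 := by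
    by_contra hcon
    push Not at hcon
    exact hq (MvPolynomial.funext fun x => by simp [hcon x])
  set v := y - x0 with hv
  have hex : ∃ k, (lineExp v q).coeff k ∉ P := by
    by_contra hcon
    push Not at hcon
    apply hy
    have h1 := lineExp_eval v x0 1 q
    have h2 : (lineExp v q).map (eval x0) = 0 := by
      ext k
      rw [Polynomial.coeff_map, Polynomial.coeff_zero]
      exact hV x0 hx0 hsx0 _ (hcon k)
    rw [h2] at h1
    simpa [hv] using h1.symm
  have hk := Nat.find_spec hex
  have hmin : ∀ j < Nat.find hex, (lineExp v q).coeff j ∈ P := fun j hj => by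
    simpa using Nat.find_min hex hj
  set k := Nat.find hex
  have hmem : s * (lineExp v q).coeff k ∈ multIdeal Z g := by
    refine ⟨s * (lineExp v p).coeff k, fun x hx => ?_⟩
    rw [map_mul, map_mul]
    by_cases hsx : eval x s = 0
    · simp [hsx]
    · have := lim_coeff (fun t => g (x + t • v)) (by fun_prop) k
        ((lineExp v q).map (eval x)) ((lineExp v p).map (eval x))
        (fun t => by rw [lineExp_eval, lineExp_eval]; exact hgq _)
        (fun j hj => by
          rw [Polynomial.coeff_map]
          exact hV x hx hsx _ (hmin j hj))
      rw [Polynomial.coeff_map, Polynomial.coeff_map] at this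
      simp only [zero_smul, add_zero] at this
      rw [← this]; ring
  exact (hP.mem_or_mem (hle hmem)).elim hs hk

theorem exists_w {n : ℕ} (Z : Set (Fin n → ℝ)) (g : (Fin n → ℝ) → ℝ)
    (hg : Continuous g) (p q : MvPolynomial (Fin n) ℝ) (hq : q ≠ 0)
    (hgq : ∀ x, g x * eval x q = eval x p)
    (hd : algDim Z ≤ (1 : WithBot ℕ∞)) :
    ∃ w Q : MvPolynomial (Fin n) ℝ, (∀ x ∈ Z, eval x w = g x * (eval x Q) ^ 2) ∧
      ∀ i, ∃ c : Polynomial ℝ, c ≠ 0 ∧ ∃ v : MvPolynomial (Fin n) ℝ,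
        ∀ x, (∀ R ∈ vanishingIdealOf {x ∈ Z | g x ≠ 0}, eval x R = 0) →
          c.eval (x i) = eval x w * eval x v := by
  obtain ⟨Q, ⟨P, hPQ⟩, hQ⟩ := exists_sq (multIdeal Z g)
  have hw : ∀ x ∈ Z, eval x (P * Q) = g x * (eval x Q) ^ 2 := by
    intro x hx
    rw [map_mul, ← hPQ x hx]; ring
  refine ⟨P * Q, Q, hw, fun i => ?_⟩
  have hIle : vanishingIdealOf Z ≤ vanishingIdealOf {x ∈ Z | g x ≠ 0} :=
    fun a ha x hx => ha x hx.1
  obtain ⟨c, hc, hcm⟩ := exists_univ (vanishingIdealOf {x ∈ Z | g x ≠ 0} ⊔ Ideal.span {P * Q}) (by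
    intro 𝔭 h𝔭 hle
    by_contra hm
    obtain ⟨s, hs, hsP⟩ := exists_annih Z hd 𝔭 h𝔭 (hIle.trans (le_sup_left.trans hle)) hm
    have hJ : ¬ multIdeal Z g ≤ 𝔭 := fun h =>
      hm (isMaximal_of_multIdeal_le Z g hg p q hq hgq hd 𝔭 h𝔭 h)
    obtain ⟨e, he, heP⟩ := SetLike.not_le_iff_exists.1 hJ
    have hwP : P * Q ∈ 𝔭 := hle (Ideal.mem_sup_right (Ideal.mem_span_singleton_self _))
    have hse : s * e ∈ vanishingIdealOf {x ∈ Z | g x ≠ 0} := by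
      rintro x ⟨hx, hgx⟩
      by_cases hQx : eval x Q = 0
      · rw [map_mul, hQ x hQx e he, mul_zero]
      · have : eval x (s * (P * Q)) = 0 := hsP _ hwP x hx
        rw [map_mul, hw x hx] at this
        have h3 : eval x s = 0 := by
          rcases mul_eq_zero.1 this with h | h
          · exact h
          · exact absurd h (mul_ne_zero hgx (pow_ne_zero _ hQx))
        rw [map_mul, h3, zero_mul]
    exact (h𝔭.mem_or_mem (hle (Ideal.mem_sup_left hse))).elim hs heP) i
  refine ⟨c, hc, ?_⟩
  obtain ⟨r, hr, u, hu, hru⟩ := Submodule.mem_sup.1 hcm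
  obtain ⟨v, rfl⟩ := Ideal.mem_span_singleton'.1 hu
  refine ⟨v, fun x hx => ?_⟩
  have h1 : eval x (Polynomial.aeval (X i : MvPolynomial (Fin n) ℝ) c) = c.eval (x i) := by
    have := Polynomial.aeval_algHom_apply (MvPolynomial.aeval x : MvPolynomial (Fin n) ℝ →ₐ[ℝ] ℝ) (X i) c
    rw [aeval_X] at this
    rw [← Polynomial.coe_aeval_eq_eval, this]
    rfl
  rw [← h1, ← hru, map_add, hx r hr, map_mul]; ring

/-- local bump polynomial at `a` -/
theorem exists_bump {n : ℕ} (Z : Set (Fin n → ℝ)) (w : MvPolynomial (Fin n) ℝ)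
    (hc : ∀ i, ∃ c : Polynomial ℝ, c ≠ 0 ∧ ∃ v : MvPolynomial (Fin n) ℝ,
        ∀ x ∈ Z, c.eval (x i) = eval x w * eval x v) (a : Fin n → ℝ) (δ : ℝ) (hδ : 0 < δ) :
    ∃ l M : MvPolynomial (Fin n) ℝ, (∀ x, 0 ≤ eval x l) ∧ 0 < eval a l ∧ (∀ x, 0 ≤ eval x M) ∧
      ∀ x ∈ Z, δ ≤ dist x a → eval x l ≤ |eval x w| * eval x M := by
  classical
  choose c hc0 v hv using hc
  have h1 : ∀ i, ∃ d : Polynomial ℝ, d.eval (a i) ≠ 0 ∧ ∃ m : ℕ, ∀ t, (c i).eval t = (t - a i) ^ m * d.eval t := by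
    intro i
    obtain ⟨d, hd, hnd⟩ := Polynomial.exists_eq_pow_rootMultiplicity_mul_and_not_dvd (c i) (hc0 i) (a i)
    refine ⟨d, fun h => hnd (Polynomial.dvd_iff_isRoot.2 h), (c i).rootMultiplicity (a i), fun t => ?_⟩
    conv_lhs => rw [hd]
    simp
  choose d hd m hm using h1
  -- one variable polynomials as multivariate ones
  let D : Fin n → MvPolynomial (Fin n) ℝ := fun i => Polynomial.aeval (X i) (d i)
  have hD : ∀ x i, eval x (D i) = (d i).eval (x i) := by
    intro x i
    have := Polynomial.aeval_algHom_apply (MvPolynomial.aeval x : MvPolynomial (Fin n) ℝ →ₐ[ℝ] ℝ) (X i) (d i)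
    rw [aeval_X] at this
    rw [← Polynomial.coe_aeval_eq_eval, this]
    rfl
  let E : Fin n → MvPolynomial (Fin n) ℝ := fun i => ∏ j ∈ Finset.univ.erase i, D j ^ 2
  have hE : ∀ x i, 0 ≤ eval x (E i) := by
    intro x i
    simp only [E, map_prod, map_pow]
    exact Finset.prod_nonneg fun j _ => sq_nonneg _
  let N : Fin n → MvPolynomial (Fin n) ℝ := fun i => C ((δ ^ m i)⁻¹) * (1 + v i ^ 2 * D i ^ 2) * E i
  have hN : ∀ x i, 0 ≤ eval x (N i) := by
    intro x i
    simp only [N, map_mul, map_add, map_pow, eval_C, map_one]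
    have := hE x i
    positivity
  refine ⟨∏ j, D j ^ 2, ∑ i, N i, ?_, ?_, ?_, ?_⟩
  · intro x
    simp only [map_prod, map_pow]
    exact Finset.prod_nonneg fun j _ => sq_nonneg _
  · simp only [map_prod, map_pow]
    exact Finset.prod_pos fun j _ => by rw [hD]; have := hd j; positivity
  · intro x
    rw [map_sum]
    exact Finset.sum_nonneg fun i _ => hN x i
  · intro x hx hxa
    obtain ⟨i, hi⟩ : ∃ i, δ ≤ |x i - a i| := by
      by_contra hcon
      push Not at hcon
      exact absurd ((dist_pi_lt_iff hδ).2 fun i => hcon i) (not_lt.2 hxa)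
    have h2 : eval x (N i) ≤ eval x (∑ i, N i) := by
      rw [map_sum]
      exact Finset.single_le_sum (f := fun i => eval x (N i)) (fun j _ => hN x j) (Finset.mem_univ i)
    refine le_trans ?_ (mul_le_mul_of_nonneg_left h2 (abs_nonneg _))
    have h3 : eval x (∏ j, D j ^ 2) = eval x (D i) ^ 2 * eval x (E i) := by
      rw [← Finset.mul_prod_erase Finset.univ _ (Finset.mem_univ i), map_mul, map_pow]
    rw [h3]
    have h4 : eval x w * eval x (v i) = (x i - a i) ^ m i * eval x (D i) := by
      rw [← hv i x hx, hm, hD]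
    have h5 : δ ^ m i * |eval x (D i)| ≤ |eval x w| * |eval x (v i)| := by
      rw [← abs_mul, h4, abs_mul, abs_pow]
      gcongr
    have h6 : |eval x (D i)| ≤ (δ ^ m i)⁻¹ * (|eval x w| * |eval x (v i)|) := by
      rw [← div_eq_inv_mul, le_div_iff₀' (by positivity)]; exact h5
    simp only [N, map_mul, map_add, map_pow, eval_C, map_one]
    rw [← mul_assoc]
    apply mul_le_mul_of_nonneg_right _ (hE x i)
    rw [← sq_abs (eval x (v i)), ← sq_abs (eval x (D i))]
    have hA := abs_nonneg (eval x (v i))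
    have hB := abs_nonneg (eval x (D i))
    have hW := abs_nonneg (eval x w)
    have hK : 0 ≤ (δ ^ m i)⁻¹ := by positivity
    generalize |eval x (v i)| = A at *
    generalize |eval x (D i)| = B at *
    generalize |eval x w| = W at *
    generalize (δ ^ m i)⁻¹ = K at *
    calc B ^ 2 = B * B := by ring
      _ ≤ (K * (W * A)) * B := by gcongr
      _ = (W * K) * (A * B) := by ring
      _ ≤ (W * K) * (1 + A ^ 2 * B ^ 2) := by
        gcongr
        nlinarith [sq_nonneg (A * B - 1)]
      _ = _ := by ring

theorem exists_h {n : ℕ} (Z : Set (Fin n → ℝ)) (w : MvPolynomial (Fin n) ℝ)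
    (hc : ∀ i, ∃ c : Polynomial ℝ, c ≠ 0 ∧ ∃ v : MvPolynomial (Fin n) ℝ,
        ∀ x ∈ Z, c.eval (x i) = eval x w * eval x v) (g : (Fin n → ℝ) → ℝ) (hg : Continuous g)
    (Q : MvPolynomial (Fin n) ℝ) (hw : ∀ x ∈ Z, eval x w = g x * (eval x Q) ^ 2) :
    ∃ h : MvPolynomial (Fin n) ℝ, ∀ x ∈ Z, Real.sign (g x) = Real.sign (eval x h) := by
  classical
  have hfin : {x ∈ Z | eval x w = 0 ∧ g x ≠ 0}.Finite := by
    choose c hc0 v hv using hc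
    apply (Set.Finite.pi' (t := fun i => {t | (c i).IsRoot t})
      fun i => Polynomial.finite_setOfPred_isRoot (hc0 i)).subset
    rintro x ⟨hx, hx0, -⟩ i
    show (c i).eval (x i) = 0
    rw [hv i x hx, hx0, zero_mul]
  have hδ : ∀ a, ∃ δ > 0, g a ≠ 0 → ∀ x, dist x a < δ → 0 < g a * g x := by
    intro a
    by_cases ha : g a = 0
    · exact ⟨1, one_pos, fun h => absurd ha h⟩
    · have : ∀ᶠ x in nhds a, 0 < g a * g x :=
        ((continuous_const.mul hg).continuousAt (x := a)).eventually
          (lt_mem_nhds (mul_self_pos.2 ha))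
      obtain ⟨δ, h1, h2⟩ := Metric.eventually_nhds_iff.1 this
      exact ⟨δ, h1, fun _ x hx => h2 hx⟩
  choose δ hδ0 hδ using hδ
  choose l M hl hla hM hlM using fun a => exists_bump Z w hc a (δ a) (hδ0 a)
  let S := hfin.toFinset
  have hS : ∀ a, a ∈ S ↔ a ∈ Z ∧ eval a w = 0 ∧ g a ≠ 0 := by
    intro a; rw [Set.Finite.mem_toFinset]; rfl
  let T : (Fin n → ℝ) → MvPolynomial (Fin n) ℝ := fun a => w * M a + C (Real.sign (g a)) * l a
  -- key sign fact
  have hT : ∀ a ∈ S, ∀ x ∈ Z, 0 ≤ eval x (T a) * g x := by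
    intro a ha x hx
    have hga := ((hS a).1 ha).2.2
    simp only [T, map_add, map_mul, eval_C]
    have hwg : 0 ≤ eval x w * g x := by
      rw [hw x hx]; nlinarith [sq_nonneg (g x * eval x Q)]
    by_cases hxa : dist x a < δ a
    · have h1 := hδ a hga x hxa
      have h2 : 0 ≤ Real.sign (g a) * g x := by
        rcases lt_or_gt_of_ne hga with h | h
        · rw [Real.sign_of_neg h]; nlinarith
        · rw [Real.sign_of_pos h]; nlinarith
      nlinarith [mul_nonneg hwg (hM a x), mul_nonneg h2 (hl a x)]
    · have h1 := hlM a x hx (not_lt.1 hxa)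
      have h2 : |eval x w| * |g x| = eval x w * g x := by rw [← abs_mul, abs_of_nonneg hwg]
      have h3 : -|g x| ≤ Real.sign (g a) * g x := by
        rcases lt_or_gt_of_ne hga with h | h
        · rw [Real.sign_of_neg h]; linarith [le_abs_self (g x)]
        · rw [Real.sign_of_pos h]; linarith [neg_abs_le (g x)]
      have h4 := mul_le_mul_of_nonneg_right h1 (abs_nonneg (g x))
      have h5 := mul_le_mul_of_nonneg_right h3 (hl a x)
      have h6 : |eval x w| * eval x (M a) * |g x| = eval x w * g x * eval x (M a) := by
        rw [← h2]; ring
      rw [h6] at h4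
      linarith
  refine ⟨w + ∑ a ∈ S, T a, fun x hx => ?_⟩
  by_cases hgx : g x = 0
  · have hwx : eval x w = 0 := by rw [hw x hx, hgx, zero_mul]
    have : eval x (w + ∑ a ∈ S, T a) = 0 := by
      rw [map_add, map_sum, hwx, zero_add]
      apply Finset.sum_eq_zero
      intro a ha
      have hga := ((hS a).1 ha).2.2
      have h1 : δ a ≤ dist x a := by
        by_contra hcon
        have := hδ a hga x (not_le.1 hcon)
        rw [hgx, mul_zero] at this
        exact lt_irrefl _ this
      have h2 := hlM a x hx h1
      rw [hwx, abs_zero, zero_mul] at h2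
      have h3 := le_antisymm h2 (hl a x)
      simp [T, hwx, h3]
    rw [this, hgx]
  · have hpos : 0 < eval x (w + ∑ a ∈ S, T a) * g x := by
      rw [map_add, map_sum, add_mul, Finset.sum_mul]
      by_cases hwx : eval x w = 0
      · have hxS : x ∈ S := (hS x).2 ⟨hx, hwx, hgx⟩
        rw [hwx, zero_mul, zero_add]
        apply Finset.sum_pos' (fun a ha => hT a ha x hx) ⟨x, hxS, ?_⟩
        simp only [T, map_add, map_mul, eval_C, hwx, zero_mul, zero_add]
        have h2 : 0 < Real.sign (g x) * g x := by
          rcases lt_or_gt_of_ne hgx with h | h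
          · rw [Real.sign_of_neg h]; linarith
          · rw [Real.sign_of_pos h]; linarith
        nlinarith [mul_pos h2 (hla x)]
      · have h1 : 0 < eval x w * g x := by
          have hQ : eval x Q ≠ 0 := by
            intro h; apply hwx; rw [hw x hx, h]; simp
          rw [hw x hx]
          have : 0 < (g x * eval x Q) ^ 2 := by positivity
          nlinarith
        exact add_pos_of_pos_of_nonneg h1 (Finset.sum_nonneg fun a ha => hT a ha x hx)
    rcases lt_or_gt_of_ne hgx with h | h
    · rw [Real.sign_of_neg h, Real.sign_of_neg (by nlinarith)]
    · rw [Real.sign_of_pos h, Real.sign_of_pos (by nlinarith)]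

end SR

/-- if `f` is regulous on `X` with `dim pol(f) ≤ 1`, then the sign of `f` is a
sum of at most three signs of polynomial functions. -/
theorem sign_regulous_three_polys_of_small_polar_locus {n : ℕ} (X : Set (Fin n → ℝ))
    (hX : IsRealAlgebraicSet X) (f : (Fin n → ℝ) → ℝ) (hf : IsRegulousOn X f)
    (hpol : algDim (polarLocus X f) ≤ (1 : WithBot ℕ∞)) :
    ∃ p₁ p₂ p₃ : MvPolynomial (Fin n) ℝ,
      ∀ x ∈ X, Real.sign (f x) =
        Real.sign (MvPolynomial.eval x p₁) + Real.sign (MvPolynomial.eval x p₂) +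
          Real.sign (MvPolynomial.eval x p₃) := by
  obtain ⟨g, ⟨hg, U, ⟨-, k0, r, hr⟩, ⟨u, hu⟩, p0, q0, hq0, hpq0⟩, hfg⟩ := hf
  -- a global identity g q = p
  obtain ⟨p, q, hq, hgq⟩ : ∃ p q : MvPolynomial (Fin n) ℝ, q ≠ 0 ∧
      ∀ x, g x * eval x q = eval x p := by
    have hmem : ∀ x, x ∉ U ↔ ∀ i, eval x (r i) = 0 := by
      intro x
      have : x ∈ Set.univ \ U ↔ x ∈ {x | ∀ i, eval x (r i) = 0} := by rw [hr]
      simpa using this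
    obtain ⟨i, hi⟩ : ∃ i, eval u (r i) ≠ 0 := by
      by_contra hcon
      push Not at hcon
      exact (hmem u).2 hcon hu
    refine ⟨p0 * r i, q0 * r i, ?_, fun x => ?_⟩
    · intro h
      have : eval u (q0 * r i) = 0 := by rw [h, map_zero]
      rw [map_mul] at this
      exact mul_ne_zero (hq0 u hu) hi this
    · rw [map_mul, map_mul]
      by_cases hx : x ∈ U
      · rw [hpq0 x hx]
        have := hq0 x hx
        field_simp
      · rw [(hmem x).1 hx i]; simp
  -- multipliers on X
  obtain ⟨Q, ⟨P, hPQ⟩, hQ⟩ := SR.exists_sq (SR.multIdeal X f)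
  have hZ : polarLocus X f = {x ∈ X | eval x Q = 0} := by
    ext x
    constructor
    · rintro ⟨hx, hxr⟩
      refine ⟨hx, ?_⟩
      by_contra hQx
      apply hxr
      obtain ⟨k, s, rfl⟩ := hX
      refine ⟨{y | (∀ i, eval y (s i) = 0) ∧ eval y Q ≠ 0}, ⟨⟨fun y hy => hy.1, k + 1, Fin.cons Q s, ?_⟩,
        P, Q, fun y hy => hy.2, fun y hy => ?_⟩, hx, hQx⟩
      · ext y
        simp only [Set.mem_sdiff, Set.mem_ofPred_eq, Fin.forall_fin_succ, Fin.cons_zero, Fin.cons_succ]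
        tauto
      · rw [eq_div_iff hy.2]; exact hPQ y hy.1
    · rintro ⟨hx, hQx⟩
      refine ⟨hx, ?_⟩
      rintro ⟨V, ⟨⟨hVX, k, s, hs⟩, P1, Q1, hQ1, hPQ1⟩, hxV⟩
      have hmem : ∀ y ∈ X, y ∉ V ↔ ∀ i, eval y (s i) = 0 := by
        intro y hy
        have : y ∈ X \ V ↔ y ∈ {x | ∀ i, eval x (s i) = 0} := by rw [hs]
        simpa [hy] using this
      obtain ⟨i, hi⟩ : ∃ i, eval x (s i) ≠ 0 := by
        by_contra hcon
        push Not at hcon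
        exact (hmem x hx).2 hcon hxV
      have hJ : Q1 * s i ∈ SR.multIdeal X f := by
        refine ⟨P1 * s i, fun y hy => ?_⟩
        rw [map_mul, map_mul]
        by_cases hyV : y ∈ V
        · rw [hPQ1 y hyV]
          have := hQ1 y hyV
          field_simp
        · rw [(hmem y hy).1 hyV i]; simp
      have := hQ x hQx _ hJ
      rw [map_mul] at this
      exact mul_ne_zero (hQ1 x hxV) hi this
  rw [hZ] at hpol
  set Z := {x ∈ X | eval x Q = 0} with hZdef
  obtain ⟨w, Q1, hw, hc⟩ := SR.exists_w Z g hg p q hq hgq hpol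
  obtain ⟨Q', hQ'mem, hQ'⟩ := SR.exists_sq (vanishingIdealOf {x ∈ Z | g x ≠ 0})
  have hQI : Q ∈ vanishingIdealOf {x ∈ Z | g x ≠ 0} := fun x hx => hx.1.2
  obtain ⟨h, hh⟩ := SR.exists_h {x ∈ X | eval x Q' = 0} w
    (fun i => by
      obtain ⟨c, hc0, v, hv⟩ := hc i
      exact ⟨c, hc0, v, fun x hx => hv x (hQ' x hx.2)⟩) g hg Q1
    (fun x hx => hw x ⟨hx.1, hQ' x hx.2 Q hQI⟩)
  refine ⟨P * Q, h, -(h * Q' ^ 2), fun x hx => ?_⟩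
  have hPQx := hPQ x hx
  by_cases hQ'x : eval x Q' = 0
  · have hQx := hQ' x hQ'x Q hQI
    rw [hfg x hx, hh x ⟨hx, hQ'x⟩]
    simp [hQx, hQ'x]
  · have h3 : Real.sign (eval x h) + Real.sign (eval x (-(h * Q' ^ 2))) = 0 := by
      have hp : 0 < eval x Q' ^ 2 := by positivity
      simp only [map_neg, map_mul, map_pow]
      rcases lt_trichotomy (eval x h) 0 with h0 | h0 | h0
      · rw [Real.sign_of_neg h0, Real.sign_of_pos (by nlinarith)]; norm_num
      · simp [h0]
      · rw [Real.sign_of_pos h0, Real.sign_of_neg (by nlinarith)]; norm_num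
    rw [add_assoc, h3, add_zero, map_mul, ← hPQx]
    by_cases hQx : eval x Q = 0
    · have hfx : f x = 0 := by
        rw [hfg x hx]
        by_contra hgx
        exact hQ'x (hQ'mem x ⟨⟨hx, hQx⟩, hgx⟩)
      simp [hfx]
    · have hp : 0 < eval x Q ^ 2 := by positivity
      rcases lt_trichotomy (f x) 0 with h0 | h0 | h0
      · rw [Real.sign_of_neg h0, Real.sign_of_neg (by nlinarith)]
      · simp [h0]
      · rw [Real.sign_of_pos h0, Real.sign_of_pos (by nlinarith)]
end

section
/- Let X ⊆ ℝⁿ be a real algebraic set of dimension d and let f be a regulous function on X. If d = 0, then sign(f) = sign(p) for a single polynomial function p on X. If d = 1, then sign(f) is a sum of at most 3 signs of polynomial functions on X. If d ≥ 2, then sign(f) is a sum of at most 2d − 1 signs of polynomial functions on X. -/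
open MvPolynomial Set

namespace SignReg

lemma mem_vi {n : ℕ} {X : Set (Fin n → ℝ)} {p : MvPolynomial (Fin n) ℝ} :
    p ∈ vanishingIdealOf X ↔ ∀ x ∈ X, MvPolynomial.eval x p = 0 := Iff.rfl

/-- Zariski closure -/
def cl {n : ℕ} (E : Set (Fin n → ℝ)) : Set (Fin n → ℝ) :=
  {x | ∀ p ∈ vanishingIdealOf E, MvPolynomial.eval x p = 0}

lemma subset_cl {n : ℕ} (E : Set (Fin n → ℝ)) : E ⊆ cl E := fun _ hx _ hp => hp _ hx

lemma vi_cl {n : ℕ} (E : Set (Fin n → ℝ)) : vanishingIdealOf (cl E) = vanishingIdealOf E := by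
  ext p
  exact ⟨fun h x hx => h x (subset_cl E hx), fun h x hx => hx p h⟩

/-- shifting along a direction -/
noncomputable def shift {n : ℕ} (v : Fin n → ℝ) :
    MvPolynomial (Fin n) ℝ →ₐ[ℝ] Polynomial (MvPolynomial (Fin n) ℝ) :=
  MvPolynomial.aeval fun i => Polynomial.C (MvPolynomial.X i) +
    Polynomial.X * Polynomial.C (MvPolynomial.C (v i))

lemma eval_shift {n : ℕ} (v x : Fin n → ℝ) (t : ℝ) (p : MvPolynomial (Fin n) ℝ) :
    ((shift v p).map (MvPolynomial.eval x)).eval t = MvPolynomial.eval (x + t • v) p := by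
  induction p using MvPolynomial.induction_on with
  | C a =>
    simp [shift, MvPolynomial.algebraMap_eq]
  | add p q hp hq => simp [hp, hq]
  | mul_X p i hp =>
    rw [map_mul, Polynomial.map_mul, Polynomial.eval_mul, hp]
    simp [shift]
    left; ring

lemma coeff_lemma (k : ℕ) : ∀ (φ : ℝ → ℝ) (_ : Continuous φ) (F G : Polynomial ℝ)
    (_ : ∀ t, φ t * F.eval t = G.eval t) (_ : ∀ i < k, F.coeff i = 0),
    φ 0 * F.coeff k = G.coeff k := by
  induction k with
  | zero =>
    intro φ _ F G h _
    simpa [Polynomial.coeff_zero_eq_eval_zero] using h 0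
  | succ k ih =>
    intro φ hφ F G h h0
    have hF0 : F.coeff 0 = 0 := h0 0 (by omega)
    have hG0 : G.coeff 0 = 0 := by
      have := h 0
      rw [← Polynomial.coeff_zero_eq_eval_zero, ← Polynomial.coeff_zero_eq_eval_zero, hF0] at this
      linarith
    have hF : F = Polynomial.X * F.divX := by
      conv_lhs => rw [← Polynomial.X_mul_divX_add F, hF0]
      simp
    have hG : G = Polynomial.X * G.divX := by
      conv_lhs => rw [← Polynomial.X_mul_divX_add G, hG0]
      simp
    have key : (fun t => φ t * F.divX.eval t) = fun t => G.divX.eval t := by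
      refine Continuous.ext_on (dense_compl_singleton (0 : ℝ)) (by fun_prop) (by fun_prop) ?_
      intro t ht
      have ht : t ≠ 0 := ht
      have := h t
      rw [hF, hG] at this
      simp only [Polynomial.eval_mul, Polynomial.eval_X] at this
      apply mul_left_cancel₀ ht
      simp only
      linarith
    have := ih φ hφ F.divX G.divX (fun t => congrFun key t) (fun i hi => by
      rw [Polynomial.coeff_divX]; exact h0 _ (by omega))
    simpa [Polynomial.coeff_divX] using this

/-- clearing denominators globally -/
lemma regulous_global {n : ℕ} {f : (Fin n → ℝ) → ℝ} (hf : IsRegulous f) :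
    ∃ P Q : MvPolynomial (Fin n) ℝ, (∃ w, MvPolynomial.eval w Q ≠ 0) ∧
      ∀ x, f x * MvPolynomial.eval x Q = MvPolynomial.eval x P := by
  obtain ⟨hc, U, ⟨-, k, r, hU⟩, ⟨w, hw⟩, p, q, hq, hpq⟩ := hf
  refine ⟨p, q, ⟨w, hq w hw⟩, fun y => ?_⟩
  have hw' : ∃ i, MvPolynomial.eval w (r i) ≠ 0 := by
    by_contra! hcon
    have : w ∈ Set.univ \ U := by rw [hU]; exact hcon
    exact this.2 hw
  obtain ⟨i, hi⟩ := hw'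
  set R : Polynomial ℝ := (shift (w - y) (r i)).map (MvPolynomial.eval y) with hR
  have hR0 : R ≠ 0 := by
    intro h0
    have := eval_shift (w - y) y 1 (r i)
    rw [← hR, h0] at this
    simp at this
    exact hi this.symm
  have hfin : (R.rootSet ℝ).Finite := Polynomial.rootSet_finite R ℝ
  have hdense : Dense ((R.rootSet ℝ)ᶜ) := Set.Countable.dense_compl ℝ (Set.Finite.countable hfin)
  have key : (fun t : ℝ => f (y + t • (w - y)) * MvPolynomial.eval (y + t • (w - y)) q) =
      fun t : ℝ => MvPolynomial.eval (y + t • (w - y)) p := by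
    refine Continuous.ext_on hdense ?_ ?_ ?_
    · exact (hc.comp (by fun_prop)).mul ((MvPolynomial.continuous_eval q).comp (by fun_prop))
    · exact (MvPolynomial.continuous_eval p).comp (by fun_prop)
    · intro t ht
      have ht' : R.eval t ≠ 0 := by
        intro h; apply ht
        rw [Polynomial.mem_rootSet]
        exact ⟨hR0, by simpa using h⟩
      rw [hR, eval_shift] at ht'
      have hmem : y + t • (w - y) ∈ U := by
        by_contra hn
        have : y + t • (w - y) ∈ Set.univ \ U := ⟨trivial, hn⟩
        rw [hU] at this
        exact ht' (this i)
      simp only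
      rw [hpq _ hmem, div_mul_cancel₀ _ (hq _ hmem)]
  have := congrFun key 0
  simpa using this

/-- denominators ideal -/
def denom {n : ℕ} (V : Set (Fin n → ℝ)) (f : (Fin n → ℝ) → ℝ) :
    Ideal (MvPolynomial (Fin n) ℝ) where
  carrier := {q | ∃ p : MvPolynomial (Fin n) ℝ,
    ∀ x ∈ V, f x * MvPolynomial.eval x q = MvPolynomial.eval x p}
  add_mem' := by
    rintro a b ⟨p, hp⟩ ⟨q, hq⟩
    exact ⟨p + q, fun x hx => by simp [mul_add, hp x hx, hq x hx]⟩
  zero_mem' := ⟨0, by simp⟩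
  smul_mem' := by
    rintro c a ⟨p, hp⟩
    exact ⟨c * p, fun x hx => by
      rw [smul_eq_mul, map_mul, map_mul, ← hp x hx]; ring⟩

lemma generic_rational {n : ℕ} (V : Set (Fin n → ℝ)) {f : (Fin n → ℝ) → ℝ} (hf : IsRegulous f) :
    ∃ p q : MvPolynomial (Fin n) ℝ,
      (∀ x ∈ V, f x * MvPolynomial.eval x q = MvPolynomial.eval x p) ∧
      ∀ b, q * b ∈ vanishingIdealOf V → b ∈ vanishingIdealOf V := by
  obtain ⟨P, Q, ⟨w, hw⟩, hPQ⟩ := regulous_global hf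
  by_contra! hcon
  set I := vanishingIdealOf V with hI
  have hdis : Disjoint (((denom V f).map (Ideal.Quotient.mk I) :
      Ideal (MvPolynomial (Fin n) ℝ ⧸ I)) : Set (MvPolynomial (Fin n) ℝ ⧸ I))
      (nonZeroDivisors (MvPolynomial (Fin n) ℝ ⧸ I) : Set (MvPolynomial (Fin n) ℝ ⧸ I)) := by
    rw [Set.disjoint_left]
    intro z hz hz'
    obtain ⟨q, ⟨p, hp⟩, rfl⟩ :=
      (Ideal.mem_map_iff_of_surjective _ Ideal.Quotient.mk_surjective).1 hz
    obtain ⟨b, hb, hb'⟩ := hcon p q hp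
    apply hb'
    rw [← Ideal.Quotient.eq_zero_iff_mem] at hb ⊢
    rw [map_mul] at hb
    exact (mem_nonZeroDivisors_iff.1 hz').1 _ hb
  have hann := Ideal.bot_lt_annihilator_of_disjoint_nonZeroDivisors hdis
  obtain ⟨-, z, hz, hz0⟩ := SetLike.lt_iff_le_and_exists.1 hann
  obtain ⟨h, rfl⟩ := Ideal.Quotient.mk_surjective z
  have hhI : h ∉ I := fun hh => hz0 (by
    rw [Ideal.Quotient.eq_zero_iff_mem.2 hh]; exact zero_mem _)
  have hD : ∀ q ∈ denom V f, h * q ∈ I := by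
    intro q hq
    have := Submodule.mem_annihilator.1 hz _ (Ideal.mem_map_of_mem (Ideal.Quotient.mk I) hq)
    rw [smul_eq_mul, ← map_mul, Ideal.Quotient.eq_zero_iff_mem] at this
    exact this
  obtain ⟨x0, hx0, hhx0⟩ : ∃ x0 ∈ V, MvPolynomial.eval x0 h ≠ 0 := by
    by_contra! hc
    exact hhI hc
  set v := w - x0
  have hex : ∃ k, h * (shift v Q).coeff k ∉ I := by
    by_contra! hc
    apply hw
    have h1 := eval_shift v x0 1 Q
    have h2 : (shift v Q).map (MvPolynomial.eval x0) = 0 := by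
      ext i
      have := hc i x0 hx0
      rw [map_mul] at this
      simpa using (mul_eq_zero.1 this).resolve_left hhx0
    rw [h2] at h1
    simpa [v] using h1.symm
  classical
  let k := Nat.find hex
  have hk : h * (shift v Q).coeff k ∉ I := Nat.find_spec hex
  have hlt : ∀ i < k, h * (shift v Q).coeff i ∈ I := fun i hi => not_not.1 (Nat.find_min hex hi)
  have hmem : h * (shift v Q).coeff k ∈ denom V f := by
    refine ⟨h * (shift v P).coeff k, fun x hx => ?_⟩
    rw [map_mul, map_mul]
    by_cases hhx : MvPolynomial.eval x h = 0
    · simp [hhx]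
    have := coeff_lemma k (fun t => f (x + t • v)) (hf.1.comp (by fun_prop))
      ((shift v Q).map (MvPolynomial.eval x)) ((shift v P).map (MvPolynomial.eval x))
      (fun t => by rw [eval_shift, eval_shift]; exact hPQ _)
      (fun i hi => by
        have := hlt i hi x hx
        rw [map_mul] at this
        simpa using (mul_eq_zero.1 this).resolve_left hhx)
    simp only [zero_smul, add_zero, Polynomial.coeff_map] at this
    rw [← this]; ring
  apply hk
  intro x hx
  have := hD _ hmem x hx
  simp only [map_mul] at this ⊢
  rcases mul_eq_zero.1 this with h | h
  · simp [h]
  · exact h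

lemma dim_drop {A : Type*} [CommRing A] {I : Ideal (A)} {q : A}
    (hq : ∀ b, q * b ∈ I → b ∈ I) {k : ℕ}
    (hI : ringKrullDim (A ⧸ I) ≤ ((k + 1 : ℕ) : WithBot ℕ∞))
    {J : Ideal (A)} (hIJ : I ≤ J) (hqJ : q ∈ J) :
    ringKrullDim (A ⧸ J) ≤ (k : WithBot ℕ∞) := by
  have hnz : Ideal.Quotient.mk I q ∈ nonZeroDivisors (A ⧸ I) := by
    rw [mem_nonZeroDivisors_iff]
    have aux : ∀ z, Ideal.Quotient.mk I q * z = 0 → z = 0 := by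
      intro z hz
      obtain ⟨b, rfl⟩ := Ideal.Quotient.mk_surjective z
      rw [← map_mul, Ideal.Quotient.eq_zero_iff_mem] at hz
      exact Ideal.Quotient.eq_zero_iff_mem.2 (hq b hz)
    exact ⟨aux, fun z hz => aux z (by rwa [mul_comm] at hz)⟩
  have h1 := (ringKrullDim_quotient_succ_le_of_nonZeroDivisor hnz).trans hI
  let φ : ((A ⧸ I) ⧸ Ideal.span {Ideal.Quotient.mk I q}) →+*
      A ⧸ J :=
    Ideal.Quotient.lift _ (Ideal.Quotient.factor hIJ) (by
      intro a ha
      have : Ideal.span {Ideal.Quotient.mk I q} ≤ RingHom.ker (Ideal.Quotient.factor hIJ) := by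
        rw [Ideal.span_singleton_le_iff_mem, RingHom.mem_ker, Ideal.Quotient.factor_mk,
          Ideal.Quotient.eq_zero_iff_mem]
        exact hqJ
      exact this ha)
  have hφ : Function.Surjective φ :=
    Ideal.Quotient.lift_surjective_of_surjective _ _ (Ideal.Quotient.factor_surjective hIJ)
  have h2 : ringKrullDim (A ⧸ J) ≤
      ringKrullDim ((A ⧸ I) ⧸ Ideal.span {Ideal.Quotient.mk I q}) :=
    ringKrullDim_le_of_surjective φ hφ
  refine h2.trans ?_
  push_cast at h1
  generalize ringKrullDim ((A ⧸ I) ⧸ Ideal.span {Ideal.Quotient.mk I q}) = D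
    at h1 ⊢
  induction D with
  | bot => exact bot_le
  | coe D =>
    induction D with
    | top => exact absurd h1 (by
        rw [not_le]; exact_mod_cast ENat.natCast_lt_top (k+1))
    | coe D =>
      norm_cast at h1 ⊢
      omega

lemma artin {n : ℕ} {J : Ideal (MvPolynomial (Fin n) ℝ)}
    (hJ : ringKrullDim (MvPolynomial (Fin n) ℝ ⧸ J) ≤ ((0 : ℕ) : WithBot ℕ∞)) :
    IsArtinianRing (MvPolynomial (Fin n) ℝ ⧸ J) :=
  isArtinianRing_iff_krullDimLE_zero.2 (Ring.krullDimLE_iff.2 hJ)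

lemma finite_zeros {n : ℕ} {J : Ideal (MvPolynomial (Fin n) ℝ)}
    (hJ : ringKrullDim (MvPolynomial (Fin n) ℝ ⧸ J) ≤ ((0 : ℕ) : WithBot ℕ∞)) :
    {x : Fin n → ℝ | ∀ p ∈ J, MvPolynomial.eval x p = 0}.Finite := by
  have := artin hJ
  let φ : {x : Fin n → ℝ | ∀ p ∈ J, MvPolynomial.eval x p = 0} →
      ((MvPolynomial (Fin n) ℝ ⧸ J) →+* ℝ) := fun x =>
    Ideal.Quotient.lift J (MvPolynomial.eval x.1) x.2
  let ψ : {x : Fin n → ℝ | ∀ p ∈ J, MvPolynomial.eval x p = 0} →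
      PrimeSpectrum (MvPolynomial (Fin n) ℝ ⧸ J) := fun x =>
    ⟨RingHom.ker (φ x), RingHom.ker_isPrime _⟩
  have hψ : Function.Injective ψ := by
    intro x y hxy
    have h1 : RingHom.ker (φ x) = RingHom.ker (φ y) := congrArg PrimeSpectrum.asIdeal hxy
    ext i
    have h2 : Ideal.Quotient.mk J (MvPolynomial.X i - MvPolynomial.C (x.1 i)) ∈
        RingHom.ker (φ x) := by
      simp [RingHom.mem_ker, φ]
    rw [h1, RingHom.mem_ker] at h2
    simp [φ] at h2
    linarith
  exact Set.finite_coe_iff.1 (Finite.of_injective ψ hψ)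

lemma sign_mul_pos' {a c : ℝ} (hc : 0 < c) : Real.sign (a * c) = Real.sign a := by
  rcases lt_trichotomy a 0 with h | h | h
  · rw [Real.sign_of_neg h, Real.sign_of_neg (mul_neg_of_neg_of_pos h hc)]
  · simp [h]
  · rw [Real.sign_of_pos h, Real.sign_of_pos (mul_pos h hc)]

lemma exists_nonneg {n : ℕ} (E : Set (Fin n → ℝ)) : ∃ h : MvPolynomial (Fin n) ℝ,
    (∀ x, 0 ≤ MvPolynomial.eval x h) ∧ ∀ x, MvPolynomial.eval x h = 0 ↔ x ∈ cl E := by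
  obtain ⟨s, hs⟩ := IsNoetherian.noetherian (vanishingIdealOf E)
  refine ⟨∑ p ∈ s, p ^ 2, fun x => ?_, fun x => ?_⟩
  · rw [map_sum]
    exact Finset.sum_nonneg fun p _ => by rw [map_pow]; positivity
  · rw [map_sum, Finset.sum_eq_zero_iff_of_nonneg (fun p _ => by rw [map_pow]; positivity)]
    constructor
    · intro h p hp
      have hle : Ideal.span (s : Set (MvPolynomial (Fin n) ℝ)) ≤
          RingHom.ker (MvPolynomial.eval x) := by
        rw [Ideal.span_le]
        intro q hq
        have := h q hq
        simpa using this
      have hs' : Ideal.span (s : Set (MvPolynomial (Fin n) ℝ)) = vanishingIdealOf E := hs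
      rw [← hs'] at hp
      exact hle hp
    · intro h p hp
      have : p ∈ vanishingIdealOf E := by
        rw [← hs]; exact Submodule.subset_span hp
      simp [h p this]

/-- squared distance to a point -/
noncomputable def sqd {n : ℕ} (s : Fin n → ℝ) : MvPolynomial (Fin n) ℝ :=
  ∑ i, (MvPolynomial.X i - MvPolynomial.C (s i)) ^ 2

lemma eval_sqd {n : ℕ} (s x : Fin n → ℝ) :
    MvPolynomial.eval x (sqd s) = ∑ i, (x i - s i) ^ 2 := by simp [sqd]

lemma sqd_self {n : ℕ} (s : Fin n → ℝ) : MvPolynomial.eval s (sqd s) = 0 := by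
  simp [eval_sqd]

lemma sqd_ge {n : ℕ} (s x : Fin n → ℝ) : dist x s ^ 2 ≤ MvPolynomial.eval x (sqd s) := by
  rw [eval_sqd]
  have h0 : 0 ≤ ∑ i, (x i - s i) ^ 2 := Finset.sum_nonneg fun i _ => sq_nonneg _
  have : dist x s ≤ √(∑ i, (x i - s i) ^ 2) := by
    rw [dist_pi_le_iff (Real.sqrt_nonneg _)]
    intro i
    apply Real.le_sqrt_of_sq_le
    rw [Real.dist_eq, sq_abs]
    exact Finset.single_le_sum (f := fun i => (x i - s i) ^ 2) (fun i _ => sq_nonneg _)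
      (Finset.mem_univ i)
  calc dist x s ^ 2 ≤ √(∑ i, (x i - s i) ^ 2) ^ 2 := by gcongr
    _ = _ := Real.sq_sqrt h0

lemma sqd_ne {n : ℕ} {s x : Fin n → ℝ} (h : x ≠ s) : MvPolynomial.eval x (sqd s) ≠ 0 := by
  have := sqd_ge s x
  have h2 : 0 < dist x s := dist_pos.2 h
  have : 0 < dist x s ^ 2 := by positivity
  linarith

lemma interp {n : ℕ} (S : Finset (Fin n → ℝ)) (φ : (Fin n → ℝ) → ℝ) :
    ∃ v : MvPolynomial (Fin n) ℝ, ∀ s ∈ S, MvPolynomial.eval s v = φ s := by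
  classical
  induction S using Finset.induction_on with
  | empty => exact ⟨0, by simp⟩
  | insert a S ha ih =>
    obtain ⟨v, hv⟩ := ih
    set c := ∏ s ∈ S, sqd s
    have hc : MvPolynomial.eval a c ≠ 0 := by
      rw [map_prod, Finset.prod_ne_zero_iff]
      exact fun s hs => sqd_ne (fun h => ha (h ▸ hs))
    refine ⟨v + MvPolynomial.C ((φ a - MvPolynomial.eval a v) / MvPolynomial.eval a c) * c, ?_⟩
    intro s hs
    rcases Finset.mem_insert.1 hs with rfl | hs
    · simp [div_mul_cancel₀ _ hc]
    · have : MvPolynomial.eval s c = 0 := by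
        rw [map_prod]
        exact Finset.prod_eq_zero hs (sqd_self s)
      simp [this, hv s hs]

/-- sum of the signs of a list -/
noncomputable def sg {n : ℕ} (L : List (MvPolynomial (Fin n) ℝ)) (x : Fin n → ℝ) : ℝ :=
  (L.map fun p => Real.sign (MvPolynomial.eval x p)).sum

/-- the inductive invariant -/
def Rep {n : ℕ} (f : (Fin n → ℝ) → ℝ) (V : Set (Fin n → ℝ)) (k : ℕ) : Prop :=
  ∃ (g : MvPolynomial (Fin n) ℝ) (L : List (MvPolynomial (Fin n) ℝ)), L.length ≤ 2 * k ∧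
    (∀ x, x ∉ V → sg L x = 0) ∧
    ∀ x ∈ V, Real.sign (f x) = Real.sign (MvPolynomial.eval x g) + sg L x

lemma rep_finite {n : ℕ} (f : (Fin n → ℝ) → ℝ) {V : Set (Fin n → ℝ)} (hV : V.Finite) :
    Rep f V 0 := by
  obtain ⟨v, hv⟩ := interp hV.toFinset f
  exact ⟨v, [], by simp, by simp [sg], fun x hx => by
    rw [hv x (by simpa using hx)]; simp [sg]⟩

/-- `f` is generically nonzero on `V` -/
def Full {n : ℕ} (f : (Fin n → ℝ) → ℝ) (V : Set (Fin n → ℝ)) : Prop :=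
  ∀ b : MvPolynomial (Fin n) ℝ, (∀ x ∈ V, f x ≠ 0 → MvPolynomial.eval x b = 0) →
    b ∈ vanishingIdealOf V

lemma step {n : ℕ} {f : (Fin n → ℝ) → ℝ} (hf : IsRegulous f) {V : Set (Fin n → ℝ)}
    (hV : cl V = V) {k : ℕ} (hk : algDim V ≤ ((k + 1 : ℕ) : WithBot ℕ∞)) :
    ∃ W, cl W = W ∧ algDim W ≤ (k : WithBot ℕ∞) ∧ Full f W ∧
      ∀ j, Rep f W j → Rep f V (j + 1) := by
  obtain ⟨p, q, hpq, hq⟩ := generic_rational V hf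
  set E : Set (Fin n → ℝ) := {x | x ∈ V ∧ MvPolynomial.eval x q = 0 ∧ f x ≠ 0} with hE
  have hEV : E ⊆ V := fun x hx => hx.1
  have hWV : cl E ⊆ V := by
    rw [← hV]
    exact fun x hx p hp => hx p (fun y hy => hp y (hEV hy))
  have hqE : q ∈ vanishingIdealOf E := fun x hx => hx.2.1
  refine ⟨cl E, ?_, ?_, ?_, ?_⟩
  · ext x
    change (∀ p ∈ vanishingIdealOf (cl E), _) ↔ _
    rw [vi_cl]; rfl
  · unfold algDim
    rw [vi_cl]
    exact dim_drop hq hk (fun p hp x hx => hp x (hEV hx)) hqE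
  · intro b hb
    rw [vi_cl]
    exact fun x hx => hb x (subset_cl E hx) hx.2.2
  · rintro j ⟨g, L, hL, hL0, hLf⟩
    obtain ⟨h, hh0, hh⟩ := exists_nonneg E
    refine ⟨p * q, g :: (-(h * g)) :: L, by simp; omega, ?_, ?_⟩
    · intro x hx
      have hxW : x ∉ cl E := fun hc => hx (hWV hc)
      have hpos : 0 < MvPolynomial.eval x h :=
        lt_of_le_of_ne (hh0 x) (fun hc => hxW ((hh x).1 hc.symm))
      have := hL0 x hxW
      simp only [sg, List.map_cons, List.sum_cons] at this ⊢
      rw [this, map_neg, map_mul, Real.sign_neg, mul_comm, sign_mul_pos' hpos]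
      ring
    · intro x hx
      by_cases hxW : x ∈ cl E
      · have h1 := hLf x hxW
        have h2 : MvPolynomial.eval x q = 0 := hxW q hqE
        have h3 := (hh x).2 hxW
        simp only [sg, List.map_cons, List.sum_cons] at h1 ⊢
        rw [h1]
        simp [h2, h3]
      · have hpos : 0 < MvPolynomial.eval x h :=
          lt_of_le_of_ne (hh0 x) (fun hc => hxW ((hh x).1 hc.symm))
        have := hL0 x hxW
        simp only [sg, List.map_cons, List.sum_cons] at this ⊢
        rw [this, map_neg, map_mul, map_mul, Real.sign_neg, mul_comm (MvPolynomial.eval x h),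
          sign_mul_pos' hpos, ← hpq x hx]
        by_cases hqx : MvPolynomial.eval x q = 0
        · have : f x = 0 := by
            by_contra hfx
            exact hxW (subset_cl E ⟨hx, hqx, hfx⟩)
          simp [this]
        · rw [mul_assoc, sign_mul_pos' (mul_self_pos.2 hqx)]
          ring

lemma curve {n : ℕ} {f : (Fin n → ℝ) → ℝ} (hf : IsRegulous f) {V : Set (Fin n → ℝ)}
    (hk : algDim V ≤ ((1 : ℕ) : WithBot ℕ∞)) (hfull : Full f V) : Rep f V 0 := by
  obtain ⟨p, q, hpq, hq⟩ := generic_rational V hf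
  have hnz : ∀ b, (p * q) * b ∈ vanishingIdealOf V → b ∈ vanishingIdealOf V := by
    intro b hb
    apply hq
    apply hfull
    intro x hx hfx
    have := hb x hx
    simp only [map_mul] at this ⊢
    by_cases hqx : MvPolynomial.eval x q = 0
    · simp [hqx]
    · rw [← hpq x hx] at this
      have : MvPolynomial.eval x b = 0 := by simpa [hfx, hqx] using this
      simp [this]
  set J := vanishingIdealOf V ⊔ Ideal.span {p * q} with hJ
  have hJdim : ringKrullDim (MvPolynomial (Fin n) ℝ ⧸ J) ≤ ((0 : ℕ) : WithBot ℕ∞) :=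
    dim_drop hnz hk le_sup_left
      (le_sup_right (a := vanishingIdealOf V) (Ideal.mem_span_singleton_self (p * q)))
  have hfin := finite_zeros hJdim
  have hart := artin hJdim
  have hSfin : {x | x ∈ V ∧ MvPolynomial.eval x q = 0 ∧ f x ≠ 0}.Finite := by
    refine hfin.subset ?_
    rintro x ⟨hxV, hqx, -⟩
    have hle : J ≤ RingHom.ker (MvPolynomial.eval x) := by
      refine sup_le (fun r hr => hr x hxV) ?_
      rw [Ideal.span_singleton_le_iff_mem, RingHom.mem_ker, map_mul, hqx, mul_zero]
    exact fun r hr => hle hr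
  set S := hSfin.toFinset
  have hS : ∀ x, x ∈ S ↔ x ∈ V ∧ MvPolynomial.eval x q = 0 ∧ f x ≠ 0 := fun x => by
    rw [Set.Finite.mem_toFinset]; rfl
  obtain ⟨v, hv⟩ := interp S f
  set c : MvPolynomial (Fin n) ℝ := ∏ s ∈ S, sqd s with hc
  have hcS : ∀ s ∈ S, MvPolynomial.eval s c = 0 := fun s hs => by
    rw [hc, map_prod]
    exact Finset.prod_eq_zero hs (sqd_self s)
  obtain ⟨N, y, hy⟩ := IsArtinian.exists_pow_succ_smul_dvd (Ideal.Quotient.mk J c)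
    (1 : MvPolynomial (Fin n) ℝ ⧸ J)
  obtain ⟨y, rfl⟩ := Ideal.Quotient.mk_surjective y
  have hmem : (1 - c * y) * c ^ N ∈ J := by
    rw [← Ideal.Quotient.eq_zero_iff_mem]
    simp only [smul_eq_mul, mul_one, Nat.succ_eq_add_one, pow_succ] at hy
    simp only [map_mul, map_sub, map_one, map_pow]
    linear_combination -hy
  obtain ⟨i, hi, a', ha', hia⟩ := Submodule.mem_sup.1 hmem
  obtain ⟨a, rfl⟩ := Ideal.mem_span_singleton'.1 ha'
  -- key identity on V
  set w := v * (1 - c * y) with hw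
  have hkey : ∀ x ∈ V, MvPolynomial.eval x w * MvPolynomial.eval x c ^ N =
      MvPolynomial.eval x (a * v) * (f x * MvPolynomial.eval x q ^ 2) := by
    intro x hx
    have h1 := congrArg (MvPolynomial.eval x) hia
    have h2 := hi x hx
    simp only [map_add, map_mul, map_sub, map_one, map_pow, h2, ← hpq x hx] at h1
    simp only [hw, map_mul, map_sub, map_one]
    linear_combination -(MvPolynomial.eval x v) * h1
  have hwS : ∀ s ∈ S, MvPolynomial.eval s w = f s := by
    intro s hs
    simp [hw, hcS s hs, hv s hs]
  -- a uniform radius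
  have hnear : ∃ ε > 0, ∀ s ∈ S, ∀ x, dist x s < ε → 0 < f x * MvPolynomial.eval x w := by
    have hloc : ∀ s ∈ S, ∀ᶠ ε in nhdsWithin (0 : ℝ) (Set.Ioi 0), ∀ x, dist x s < ε →
        0 < f x * MvPolynomial.eval x w := by
      intro s hs
      have hcont : Continuous fun x => f x * MvPolynomial.eval x w :=
        hf.1.mul (MvPolynomial.continuous_eval w)
      have hpos : 0 < f s * MvPolynomial.eval s w := by
        rw [hwS s hs]
        exact mul_self_pos.2 ((hS s).1 hs).2.2
      obtain ⟨δ, hδ, hδ'⟩ := Metric.eventually_nhds_iff.1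
        (hcont.continuousAt.eventually (lt_mem_nhds hpos))
      filter_upwards [Ioo_mem_nhdsGT hδ] with ε hε x hx
      exact hδ' (hx.trans hε.2)
    have hall := (Filter.eventually_all_finset S).2 hloc
    obtain ⟨ε, h1, h2⟩ := (hall.and self_mem_nhdsWithin).exists
    exact ⟨ε, h2, h1⟩
  obtain ⟨ε, hε, hnear⟩ := hnear
  set η : ℝ := ((ε ^ 2) ^ S.card) ^ N with hη
  have hηpos : 0 < η := by positivity
  set K : ℝ := η⁻¹ with hK
  have hKpos : 0 < K := by positivity
  refine ⟨MvPolynomial.C K * (1 + (a * v) ^ 2) * (p * q) + w, [], by simp, by simp [sg], ?_⟩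
  intro x hx
  simp only [sg, List.map_nil, List.sum_nil, add_zero]
  set A := MvPolynomial.eval x (a * v) with hA
  have hev : MvPolynomial.eval x (MvPolynomial.C K * (1 + (a * v) ^ 2) * (p * q) + w) =
      K * (1 + A ^ 2) * (f x * MvPolynomial.eval x q ^ 2) + MvPolynomial.eval x w := by
    simp only [hA, map_add, map_mul, map_pow, map_one, MvPolynomial.eval_C, ← hpq x hx]
    ring
  rw [hev]
  have hq2 : 0 ≤ MvPolynomial.eval x q ^ 2 := sq_nonneg _
  have hKA : 0 < K * (1 + A ^ 2) := by positivity
  by_cases hxn : ∃ s ∈ S, dist x s < ε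
  · obtain ⟨s, hs, hxs⟩ := hxn
    have hpos := hnear s hs x hxs
    have hc0 : 0 ≤ K * (1 + A ^ 2) * MvPolynomial.eval x q ^ 2 := by positivity
    rcases lt_trichotomy (f x) 0 with h | h | h
    · have hw0 : MvPolynomial.eval x w < 0 := by
        by_contra! hcon
        nlinarith
      rw [Real.sign_of_neg h, Real.sign_of_neg]
      nlinarith
    · simp [h] at hpos
    · have hw0 : 0 < MvPolynomial.eval x w := by
        by_contra! hcon
        nlinarith
      rw [Real.sign_of_pos h, Real.sign_of_pos]
      nlinarith
  · push Not at hxn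
    have hcx : η ≤ MvPolynomial.eval x c ^ N := by
      rw [hη]
      gcongr
      rw [hc, map_prod]
      rw [← Finset.prod_const]
      refine Finset.prod_le_prod (fun _ _ => by positivity) ?_
      intro s hs
      exact le_trans (by gcongr; exact hxn s hs) (sqd_ge s x)
    have hcpos : 0 < MvPolynomial.eval x c ^ N := hηpos.trans_le hcx
    have hk := hkey x hx
    by_cases hg : f x * MvPolynomial.eval x q ^ 2 = 0
    · rw [hg, mul_zero] at hk
      have hw0 : MvPolynomial.eval x w = 0 := (mul_eq_zero.1 hk).resolve_right hcpos.ne'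
      have hf0 : f x = 0 := by
        by_contra hfx
        have hqx : MvPolynomial.eval x q = 0 := by simpa [hfx] using hg
        have := hxn x ((hS x).2 ⟨hx, hqx, hfx⟩)
        rw [dist_self] at this
        linarith
      simp [hf0, hw0]
    · have hqx : 0 < MvPolynomial.eval x q ^ 2 :=
        lt_of_le_of_ne hq2 (fun hc => hg (by rw [← hc, mul_zero]))
      set G := f x * MvPolynomial.eval x q ^ 2 with hG
      have hwb : |MvPolynomial.eval x w| < K * (1 + A ^ 2) * |G| := by
        have h1 : |MvPolynomial.eval x w| * MvPolynomial.eval x c ^ N = |A| * |G| := by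
          rw [← abs_mul A G, hA, ← hk, abs_mul, abs_of_pos hcpos]
        have h2 : |MvPolynomial.eval x w| * η ≤ |A| * |G| := by
          rw [← h1]; gcongr
        have hG0 : 0 < |G| := abs_pos.2 hg
        have h3 : |A| < 1 + A ^ 2 := by
          rw [← sq_abs A]; nlinarith [sq_nonneg (|A| - 1), abs_nonneg A]
        have h4 : |MvPolynomial.eval x w| * η < (1 + A ^ 2) * |G| :=
          h2.trans_lt (by gcongr)
        rw [hK, mul_assoc, ← div_eq_inv_mul, lt_div_iff₀ hηpos]
        exact h4
      have hsG : Real.sign (f x) = Real.sign G := by rw [hG, sign_mul_pos' hqx]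
      rw [hsG]
      rcases lt_or_gt_of_ne hg with h | h
      · rw [abs_of_neg h] at hwb
        have := (abs_lt.1 hwb).2
        rw [Real.sign_of_neg h, Real.sign_of_neg]
        linarith
      · rw [abs_of_pos h] at hwb
        have := (abs_lt.1 hwb).1
        rw [Real.sign_of_pos h, Real.sign_of_pos]
        linarith

lemma main_full {n : ℕ} {f : (Fin n → ℝ) → ℝ} (hf : IsRegulous f) (k : ℕ) :
    ∀ V : Set (Fin n → ℝ), cl V = V → algDim V ≤ ((k + 1 : ℕ) : WithBot ℕ∞) → Full f V →
      Rep f V k := by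
  induction k with
  | zero => exact fun V _ hd hF => curve hf hd hF
  | succ k ih =>
    intro V hV hd _
    obtain ⟨W, hW, hWd, hWF, hrep⟩ := step hf hV hd
    exact hrep k (ih W hW hWd hWF)

lemma cl_alg {n : ℕ} {X : Set (Fin n → ℝ)} (hX : IsRealAlgebraicSet X) : cl X = X := by
  obtain ⟨k, p, rfl⟩ := hX
  refine Set.Subset.antisymm (fun x hx i => hx (p i) (fun y hy => hy i)) (subset_cl _)

lemma finite_of_dim {n : ℕ} {X : Set (Fin n → ℝ)} (hX : cl X = X)
    (hd : algDim X ≤ ((0 : ℕ) : WithBot ℕ∞)) : X.Finite := by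
  rw [← hX]
  exact finite_zeros hd

lemma rep_fin {n : ℕ} {f : (Fin n → ℝ) → ℝ} {X : Set (Fin n → ℝ)} {k : ℕ} (h : Rep f X k) :
    ∃ (m : ℕ) (p : Fin m → MvPolynomial (Fin n) ℝ), m ≤ 2 * k + 1 ∧
        ∀ x ∈ X, Real.sign (f x) = ∑ i, Real.sign (MvPolynomial.eval x (p i)) := by
  obtain ⟨g, L, hL, -, hf⟩ := h
  refine ⟨(g :: L).length, (g :: L).get, by simpa using hL, fun x hx => ?_⟩
  rw [hf x hx]
  have : Real.sign (MvPolynomial.eval x g) + sg L x = sg (g :: L) x := by simp [sg]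
  rw [this, sg, ← Fin.sum_univ_fun_getElem]
  rfl

end SignReg

/-- length bounds for signs of regulous functions on a real algebraic set `X`
of dimension `d`: one polynomial if `d = 0`, at most `3` if `d = 1`, at most `2d - 1` if
`d ≥ 2`. -/
theorem sign_regulous_length_bounds {n d : ℕ} (X : Set (Fin n → ℝ))
    (hX : IsRealAlgebraicSet X) (hd : algDim X = (d : WithBot ℕ∞))
    (f : (Fin n → ℝ) → ℝ) (hf : IsRegulousOn X f) :
    (d = 0 → ∃ p : MvPolynomial (Fin n) ℝ,
        ∀ x ∈ X, Real.sign (f x) = Real.sign (MvPolynomial.eval x p)) ∧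
    (d = 1 → ∃ (m : ℕ) (p : Fin m → MvPolynomial (Fin n) ℝ), m ≤ 3 ∧
        ∀ x ∈ X, Real.sign (f x) = ∑ i, Real.sign (MvPolynomial.eval x (p i))) ∧
    (2 ≤ d → ∃ (m : ℕ) (p : Fin m → MvPolynomial (Fin n) ℝ), m ≤ 2 * d - 1 ∧
        ∀ x ∈ X, Real.sign (f x) = ∑ i, Real.sign (MvPolynomial.eval x (p i))) := by
  obtain ⟨g, hg, hfg⟩ := hf
  have hcl := SignReg.cl_alg hX
  refine ⟨?_, ?_, ?_⟩
  · rintro rfl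
    obtain ⟨v, hv⟩ := SignReg.interp (SignReg.finite_of_dim hcl hd.le).toFinset f
    exact ⟨v, fun x hx => by rw [hv x (by simpa using hx)]⟩
  · rintro rfl
    obtain ⟨W, hW, hWd, -, hrep⟩ := SignReg.step hg hcl (k := 0) hd.le
    obtain ⟨m, p, hm, hp⟩ := SignReg.rep_fin
      (hrep 0 (SignReg.rep_finite g (SignReg.finite_of_dim hW hWd)))
    exact ⟨m, p, by omega, fun x hx => by rw [hfg x hx]; exact hp x hx⟩
  · intro h2
    obtain ⟨e, rfl⟩ : ∃ e, d = e + 1 + 1 := ⟨d - 2, by omega⟩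
    obtain ⟨W, hW, hWd, hWF, hrep⟩ := SignReg.step hg hcl (k := e + 1) hd.le
    obtain ⟨m, p, hm, hp⟩ := SignReg.rep_fin (hrep e (SignReg.main_full hg e W hW hWd hWF))
    exact ⟨m, p, by omega, fun x hx => by rw [hfg x hx]; exact hp x hx⟩
end
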